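/- arXiv:2005.11390 — 3 statements merged into one kernel-verified Lean document; each statement's English description precedes it below -/
import Mathlib

section
/- Assume φ is vertically broad* Hölder on U and that there exists a continuous ω = (ω_2,…,ω_m) : U → ℝ^{m−1} such that D^φφ = ω in the broad* sense on U. Then φ ∈ UID(U), and at every a_0 ∈ U the intrinsic gradient satisfies ∇^φφ(a_0) = ω(a_0). -/
open MeasureTheory Filter Topology

namespace Step2

/-- The underlying space of the step-2 Carnot group `G = ℝ^m × ℝ^h`. -/
abbrev G (m h : ℕ) := (Fin m → ℝ) × (Fin h → ℝ)

variable {m h : ℕ}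

/-- Group product `(x,y)·(x',y') = (x+x', y+y' - (1/2)⟨Bx,x'⟩)`. -/
noncomputable def gmul (B : Fin h → Matrix (Fin m) (Fin m) ℝ) (p q : G m h) : G m h :=
  (p.1 + q.1, fun i => p.2 i + q.2 i - (1 / 2) * ∑ j, ∑ k, B i j k * p.1 k * q.1 j)

/-- Group inverse `g⁻¹ = -g`. -/
def ginv (p : G m h) : G m h := (-p.1, -p.2)

/-- Homogeneous norm `‖(x,y)‖ = Σ|x_j| + Σ|y_i|^(1/2)`. -/
noncomputable def hnorm (p : G m h) : ℝ :=
  (∑ j, |p.1 j|) + ∑ i, Real.sqrt |p.2 i|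

/-- Homogeneous (quasi-)distance `d(p,q) = ‖p⁻¹·q‖`. -/
noncomputable def gdist (B : Fin h → Matrix (Fin m) (Fin m) ℝ) (p q : G m h) : ℝ :=
  hnorm (gmul B (ginv p) q)

/-- Euclidean distance on `G`. -/
noncomputable def eDist (p q : G m h) : ℝ :=
  Real.sqrt ((∑ j, (p.1 j - q.1 j) ^ 2) + ∑ i, (p.2 i - q.2 i) ^ 2)

/-- The subgroup `W = {x_1 = 0}`. -/
def Wset (m h : ℕ) [NeZero m] : Set (G m h) := {p | p.1 0 = 0}

/-- `U` is (relatively) open in `W`. -/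
def RelOpen (m h : ℕ) [NeZero m] (U : Set (G m h)) : Prop :=
  ∃ O : Set (G m h), IsOpen O ∧ U = O ∩ Wset m h

/-- The graphing map `Φ(w) = (φ(w),0,…,0) ∈ L`. -/
noncomputable def Phi [NeZero m] (φ : G m h → ℝ) (w : G m h) : G m h :=
  ((fun j => if j = 0 then φ w else 0), 0)

/-- Horizontal coordinate vector `e_{x_j}`. -/
def eH (m h : ℕ) (j : Fin m) : G m h := ((fun j' => if j' = j then 1 else 0), 0)

/-- Vertical coordinate vector `e_{y_i}`. -/
def eV (m h : ℕ) (i : Fin h) : G m h := (0, fun i' => if i' = i then 1 else 0)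

/-- The projected vector field `D^φ_j` (for `j ≠ 0`, i.e. `j = 2,…,m` in 1-based indexing):
`D^φ_j|_w = ∂_{x_j} - Σ_i ( b^(i)_{j1} φ(w) + (1/2) Σ_{k≥2} x_k b^(i)_{jk} ) ∂_{y_i}`. -/
noncomputable def Dvec [NeZero m] (B : Fin h → Matrix (Fin m) (Fin m) ℝ)
    (φ : G m h → ℝ) (j : Fin m) (w : G m h) : G m h :=
  ((fun j' => if j' = j then 1 else 0),
   fun i => -(B i j 0 * φ w
      + (1 / 2) * ∑ k ∈ Finset.univ.erase (0 : Fin m), w.1 k * B i j k))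

/-- `D^φφ = ω` in the broad* sense on `U`. -/
def IsBroadStar [NeZero m] (B : Fin h → Matrix (Fin m) (Fin m) ℝ) (U : Set (G m h))
    (φ : G m h → ℝ) (ω : G m h → Fin m → ℝ) : Prop :=
  ∀ a₀ ∈ U, ∃ δ₁ δ₂ : ℝ, 0 < δ₂ ∧ δ₂ < δ₁ ∧
    ∀ j : Fin m, j ≠ 0 → ∃ E : G m h → ℝ → G m h,
      ∀ a, a ∈ U → eDist a a₀ ≤ δ₂ →
        (∀ t ∈ Set.Icc (-δ₂) δ₂, E a t ∈ U ∧ eDist (E a t) a₀ ≤ δ₁) ∧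
        E a 0 = a ∧
        (∀ t ∈ Set.Icc (-δ₂) δ₂,
          HasDerivWithinAt (E a) (Dvec B φ j (E a t)) (Set.Icc (-δ₂) δ₂) t) ∧
        (∀ t ∈ Set.Icc (-δ₂) δ₂, φ (E a t) - φ a = ∫ s in (0:ℝ)..t, ω (E a s) j)

/-- `φ` is vertically broad* Hölder on `U`. -/
def VertHolder (m h : ℕ) [NeZero m] (U : Set (G m h)) (φ : G m h → ℝ) : Prop :=
  ∀ a₀ ∈ U, ∃ U' : Set (G m h), RelOpen m h U' ∧ a₀ ∈ U' ∧
    IsCompact (closure U') ∧ closure U' ⊆ U ∧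
    ∀ i : Fin h, ∀ ε > (0:ℝ), ∃ ρ > (0:ℝ), ∀ p ∈ U', ∀ q ∈ U',
      p.1 = q.1 → (∀ i' : Fin h, i' ≠ i → p.2 i' = q.2 i') →
      0 < |p.2 i - q.2 i| → |p.2 i - q.2 i| ≤ ρ →
      |φ p - φ q| ≤ ε * Real.sqrt |p.2 i - q.2 i|

/-- The translated point `Φ(a)⁻¹·a⁻¹·b·Φ(a)`. -/
noncomputable def shiftQ [NeZero m] (B : Fin h → Matrix (Fin m) (Fin m) ℝ)
    (φ : G m h → ℝ) (a b : G m h) : G m h :=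
  gmul B (gmul B (gmul B (ginv (Phi φ a)) (ginv a)) b) (Phi φ a)

/-- `φ` is intrinsically differentiable at `a₀` with intrinsic gradient `grad`. -/
def IDAt [NeZero m] (B : Fin h → Matrix (Fin m) (Fin m) ℝ) (U : Set (G m h))
    (φ : G m h → ℝ) (a₀ : G m h) (grad : Fin m → ℝ) : Prop :=
  ∀ ε > (0:ℝ), ∃ r > (0:ℝ), ∀ b ∈ U, 0 < gdist B a₀ b → gdist B a₀ b < r →
    |φ b - φ a₀ - ∑ j ∈ Finset.univ.erase (0 : Fin m), grad j * (b.1 j - a₀.1 j)|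
      ≤ ε * hnorm (shiftQ B φ a₀ b)

/-- `φ` is uniformly intrinsically differentiable at `a₀` with intrinsic gradient `grad`. -/
def UIDAt [NeZero m] (B : Fin h → Matrix (Fin m) (Fin m) ℝ) (U : Set (G m h))
    (φ : G m h → ℝ) (a₀ : G m h) (grad : Fin m → ℝ) : Prop :=
  ∀ ε > (0:ℝ), ∃ r > (0:ℝ), ∀ a ∈ U, ∀ b ∈ U,
    gdist B a₀ a < r → gdist B a₀ b < r → a ≠ b →
    |φ b - φ a - ∑ j ∈ Finset.univ.erase (0 : Fin m), grad j * (b.1 j - a.1 j)|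
      ≤ ε * hnorm (shiftQ B φ a b)

/-- Projection onto `L` in the splitting `G = W·L`. -/
def piL (m h : ℕ) [NeZero m] (g : G m h) : G m h :=
  ((fun j => if j = 0 then g.1 0 else 0), 0)

/-- Projection onto `W` in the splitting `G = W·L`. -/
noncomputable def piW [NeZero m] (B : Fin h → Matrix (Fin m) (Fin m) ℝ) (g : G m h) : G m h :=
  ((fun j => if j = 0 then 0 else g.1 j),
   fun i => g.2 i + (1 / 2) * g.1 0 * ∑ k ∈ Finset.univ.erase (0 : Fin m), B i 0 k * g.1 k)

/-- Coordinates `ℝ^(m-1) × ℝ^h → W ⊆ G`. -/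
def emb (m h : ℕ) (u : (Fin (m - 1) → ℝ) × (Fin h → ℝ)) : G m h :=
  ((fun j => if hj : (j : ℕ) = 0 then 0
      else u.1 ⟨(j : ℕ) - 1, by have := j.isLt; omega⟩), u.2)

/-- The Lebesgue measure on `W`, as a measure on `G`. -/
noncomputable def muW (m h : ℕ) : Measure (G m h) :=
  Measure.map (emb m h) volume

end Step2

namespace Step2

/-- A curve whose speed is less than `K` as long as it stays within distance `η` of `p`
cannot leave that neighbourhood before time `(η - ‖γ 0 - p‖) / K`. -/
lemma norm_sub_le_of_speed_lt {E : Type*} [NormedAddCommGroup E] [NormedSpace ℝ E]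
    {γ v : ℝ → E} {δ t K η : ℝ} {p : E} (ht : t ∈ Set.Icc (-δ) δ)
    (hγ : ∀ s ∈ Set.Icc (-δ) δ, HasDerivWithinAt γ (v s) (Set.Icc (-δ) δ) s)
    (hv : ∀ s ∈ Set.Icc (-δ) δ, ‖γ s - p‖ < η → ‖v s‖ < K) (hK : 0 ≤ K)
    (hη : ‖γ 0 - p‖ + K * |t| < η) : ‖γ t - p‖ ≤ ‖γ 0 - p‖ + K * |t| := by
  rcases eq_or_ne t 0 with rfl | ht0
  · simp
  have htpos : 0 < |t| := abs_pos.mpr ht0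
  have hmap : Set.MapsTo (fun s : ℝ => s * t) (Set.Icc 0 1) (Set.Icc (-δ) δ) := by
    intro s hs
    have h1 : |s * t| ≤ δ := by
      rw [abs_mul, abs_of_nonneg hs.1]
      exact (mul_le_of_le_one_left (abs_nonneg t) hs.2).trans (abs_le.mpr ht)
    exact abs_le.mp h1
  have hd : ∀ s ∈ Set.Icc (0 : ℝ) 1,
      HasDerivWithinAt (fun s => γ (s * t) - p) (t • v (s * t)) (Set.Icc 0 1) s := by
    intro s hs
    have h1 : HasDerivWithinAt (fun s : ℝ => s * t) t (Set.Icc 0 1) s := by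
      simpa using (hasDerivWithinAt_id s (Set.Icc (0 : ℝ) 1)).mul_const t
    exact ((hγ _ (hmap hs)).scomp s h1 hmap).sub_const p
  have key := image_norm_le_of_norm_deriv_right_lt_deriv_boundary
    (f := fun s => γ (s * t) - p) (f' := fun s => t • v (s * t)) (a := 0) (b := 1)
    (B := fun s => ‖γ 0 - p‖ + (K * |t|) * s) (B' := fun _ => K * |t|)
    (fun s hs => (hd s hs).continuousWithinAt)
    (fun s hs => (hd s ⟨hs.1, hs.2.le⟩).mono_of_mem_nhdsWithin
      (mem_of_superset (Icc_mem_nhdsGE hs.2) (Set.Icc_subset_Icc_left hs.1)))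
    (by simp)
    (fun s => by simpa using ((hasDerivAt_id s).const_mul (K * |t|)).const_add ‖γ 0 - p‖)
    (fun s hs hs' => by
      have h1 : K * |t| * s ≤ K * |t| := mul_le_of_le_one_right (by positivity) hs.2.le
      have h2 := hv _ (hmap ⟨hs.1, hs.2.le⟩) (by rw [hs']; linarith)
      rw [norm_smul, Real.norm_eq_abs, mul_comm K]
      exact mul_lt_mul_of_pos_left h2 htpos)
    (Set.right_mem_Icc.mpr zero_le_one)
  simpa using key

variable {B : Fin h → Matrix (Fin m) (Fin m) ℝ}

lemma skew_apply (hB : ∀ i, (B i).transpose = -B i) (i : Fin h) (j k : Fin m) :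
    B i j k = -B i k j := by
  have := congrFun (congrFun (hB i) k) j
  simpa using this

lemma sum_skew_self (hB : ∀ i, (B i).transpose = -B i) (i : Fin h) (x : Fin m → ℝ) :
    ∑ j, ∑ k, B i j k * x k * x j = 0 := by
  have h1 : ∑ j, ∑ k, B i j k * x k * x j = -∑ j, ∑ k, B i j k * x k * x j := by
    conv_lhs => rw [Finset.sum_comm]
    rw [← Finset.sum_neg_distrib]
    refine Finset.sum_congr rfl fun j _ => ?_
    rw [← Finset.sum_neg_distrib]
    refine Finset.sum_congr rfl fun k _ => ?_
    rw [skew_apply hB i k j]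
    ring
  linarith

lemma gmul_ginv_cancel_left (hB : ∀ i, (B i).transpose = -B i) (p q : G m h) :
    gmul B p (gmul B (ginv p) q) = q := by
  ext i
  · simp [gmul, ginv]
  · have h1 := sum_skew_self hB i p.1
    have h2 : ∑ j, ∑ k, B i j k * p.1 k * (-p.1 j + q.1 j)
        = ∑ j, ∑ k, B i j k * p.1 k * q.1 j - ∑ j, ∑ k, B i j k * p.1 k * p.1 j := by
      simp only [← Finset.sum_sub_distrib]
      refine Finset.sum_congr rfl fun j _ => Finset.sum_congr rfl fun k _ => by ring
    have h3 : ∑ j, ∑ k, B i j k * -p.1 k * q.1 j = -∑ j, ∑ k, B i j k * p.1 k * q.1 j := by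
      simp only [← Finset.sum_neg_distrib]
      refine Finset.sum_congr rfl fun j _ => Finset.sum_congr rfl fun k _ => by ring
    simp only [gmul, ginv, Pi.add_apply, Pi.neg_apply, h2, h3, h1]
    ring

lemma norm_lt_of_hnorm_lt {p : G m h} {r : ℝ} (hr1 : r ≤ 1) (hp : hnorm p < r) : ‖p‖ < r := by
  have h1 : 0 ≤ ∑ j, |p.1 j| := Finset.sum_nonneg fun j _ => abs_nonneg _
  have h2 : 0 ≤ ∑ i, Real.sqrt |p.2 i| := Finset.sum_nonneg fun i _ => Real.sqrt_nonneg _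
  unfold hnorm at hp
  have hr : 0 < r := by linarith
  refine max_lt ((pi_norm_lt_iff hr).mpr fun j => ?_) ((pi_norm_lt_iff hr).mpr fun i => ?_)
  · have := Finset.single_le_sum (f := fun j => |p.1 j|) (fun j _ => abs_nonneg _)
      (Finset.mem_univ j)
    rw [Real.norm_eq_abs]
    linarith
  · have h3 := Finset.single_le_sum (f := fun i => Real.sqrt |p.2 i|)
      (fun i _ => Real.sqrt_nonneg _) (Finset.mem_univ i)
    have h4 : Real.sqrt |p.2 i| < r := by linarith
    rw [Real.norm_eq_abs]
    have h5 := (Real.sqrt_lt' hr).mp h4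
    nlinarith

lemma exists_gdist_lt_imp (hB : ∀ i, (B i).transpose = -B i) (p : G m h) {η : ℝ} (hη : 0 < η) :
    ∃ r > (0 : ℝ), ∀ q, gdist B p q < r → ‖q - p‖ < η := by
  have hc : Continuous (gmul B p) := by
    unfold gmul
    fun_prop
  have h0 : gmul B p 0 = p := by
    ext i <;> simp [gmul]
  obtain ⟨r, hr, hball⟩ := Metric.continuousAt_iff.mp (hc.continuousAt (x := 0)) η hη
  refine ⟨min r 1, lt_min hr one_pos, fun q hq => ?_⟩
  have h1 := norm_lt_of_hnorm_lt (min_le_right _ _) hq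
  have h2 := hball (x := gmul B (ginv p) q) (by
    rw [dist_zero_right]; exact h1.trans_le (min_le_left _ _))
  rwa [gmul_ginv_cancel_left hB, h0, dist_eq_norm] at h2

lemma continuous_eDist_left (p : G m h) : Continuous fun q => eDist q p := by
  unfold eDist
  fun_prop

variable [NeZero m]

lemma shiftQ_fst (φ : G m h → ℝ) (a b : G m h) : (shiftQ B φ a b).1 = b.1 - a.1 := by
  ext j
  simp only [shiftQ, gmul, ginv, Pi.add_apply, Pi.neg_apply, Pi.sub_apply]
  ring

lemma shiftQ_snd (hB : ∀ i, (B i).transpose = -B i) (φ : G m h → ℝ) {a b : G m h}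
    (ha : a ∈ Wset m h) (hb : b ∈ Wset m h) (i : Fin h) :
    (shiftQ B φ a b).2 i = b.2 i - a.2 i
      + ∑ j ∈ Finset.univ.erase (0 : Fin m), (B i j 0 * φ a * (b.1 j - a.1 j)
        + (1 / 2) * (b.1 j - a.1 j) * ∑ k ∈ Finset.univ.erase (0 : Fin m), a.1 k * B i j k) := by
  have ha0 : a.1 0 = 0 := ha
  have hb0 : b.1 0 = 0 := hb
  have hB00 : B i 0 0 = 0 := by linarith [skew_apply hB i 0 0]
  have hk : ∀ j, ∑ k ∈ Finset.univ.erase (0 : Fin m), a.1 k * B i j k = ∑ k, B i j k * a.1 k := by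
    intro j
    rw [← Finset.add_sum_erase Finset.univ _ (Finset.mem_univ (0 : Fin m)), ha0]
    simp [mul_comm]
  have hj : ∑ j ∈ Finset.univ.erase (0 : Fin m), (B i j 0 * φ a * (b.1 j - a.1 j)
        + (1 / 2) * (b.1 j - a.1 j) * ∑ k ∈ Finset.univ.erase (0 : Fin m), a.1 k * B i j k)
      = ∑ j, (B i j 0 * φ a * (b.1 j - a.1 j)
        + (1 / 2) * (b.1 j - a.1 j) * ∑ k, B i j k * a.1 k) := by
    rw [← Finset.add_sum_erase Finset.univ _ (Finset.mem_univ (0 : Fin m))]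
    simp only [hk, ha0, hb0]
    ring
  have hs := sum_skew_self hB i a.1
  have e1 : ∑ j, ∑ k, B i j k * (-(if k = 0 then φ a else 0)) * (-a.1 j)
      = φ a * ∑ j, B i j 0 * a.1 j := by
    rw [Finset.mul_sum]
    refine Finset.sum_congr rfl fun j _ => ?_
    rw [Finset.sum_eq_single 0 (by intro k _ hk; simp [hk]) (by simp)]
    simp
    ring
  have e2 : ∑ j, ∑ k, B i j k * (-(if k = 0 then φ a else 0) + -a.1 k) * b.1 j
      = -φ a * ∑ j, B i j 0 * b.1 j - ∑ j, ∑ k, B i j k * a.1 k * b.1 j := by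
    rw [Finset.mul_sum, ← Finset.sum_sub_distrib]
    refine Finset.sum_congr rfl fun j _ => ?_
    have : -φ a * (B i j 0 * b.1 j) = ∑ k, B i j k * (-(if k = 0 then φ a else 0)) * b.1 j := by
      rw [Finset.sum_eq_single 0 (by intro k _ hk; simp [hk]) (by simp)]
      simp
      ring
    rw [this, ← Finset.sum_sub_distrib]
    exact Finset.sum_congr rfl fun k _ => by ring
  have e3 : ∑ j, ∑ k, B i j k * (-(if k = 0 then φ a else 0) + -a.1 k + b.1 k)
        * (if j = 0 then φ a else 0)
      = -φ a * ∑ k, B i k 0 * (b.1 k - a.1 k) := by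
    rw [Finset.sum_eq_single 0 (by intro j _ hj; simp [hj]) (by simp), Finset.mul_sum]
    refine Finset.sum_congr rfl fun k _ => ?_
    rw [skew_apply hB i 0 k]
    rcases eq_or_ne k 0 with rfl | hk
    · simp [hB00]
    · simp [hk]
      ring
  have e4 : ∑ j, (B i j 0 * φ a * (b.1 j - a.1 j)
        + (1 / 2) * (b.1 j - a.1 j) * ∑ k, B i j k * a.1 k)
      = φ a * ∑ j, B i j 0 * b.1 j - φ a * ∑ j, B i j 0 * a.1 j
        + (1 / 2) * ∑ j, ∑ k, B i j k * a.1 k * b.1 j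
        - (1 / 2) * ∑ j, ∑ k, B i j k * a.1 k * a.1 j := by
    simp only [← Finset.sum_mul, Finset.mul_sum, ← Finset.sum_sub_distrib,
      ← Finset.sum_add_distrib]
    refine Finset.sum_congr rfl fun j _ => ?_
    simp only [← Finset.mul_sum]
    ring
  have e5 : ∑ k, B i k 0 * (b.1 k - a.1 k) = ∑ j, B i j 0 * b.1 j - ∑ j, B i j 0 * a.1 j := by
    simp only [mul_sub, Finset.sum_sub_distrib]
  rw [hj, e4, hs]
  simp only [shiftQ, gmul, ginv, Phi, Pi.add_apply, Pi.neg_apply, Pi.zero_apply, e1, e2, e3, e5]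
  ring

/-- Mean value estimate on an interval, in the form `f t - f 0 - c t = O(t)`. -/
lemma abs_sub_sub_mul_le {f f' : ℝ → ℝ} {δ t c C : ℝ} (ht : |t| ≤ δ)
    (hf : ∀ s ∈ Set.Icc (-δ) δ, HasDerivWithinAt f (f' s) (Set.Icc (-δ) δ) s)
    (hC : ∀ s, |s| ≤ |t| → |f' s - c| ≤ C) : |f t - f 0 - c * t| ≤ C * |t| := by
  have hsub : Set.Icc (-|t|) |t| ⊆ Set.Icc (-δ) δ := Set.Icc_subset_Icc (neg_le_neg ht) ht
  have key := (convex_Icc (-|t|) |t|).norm_image_sub_le_of_norm_hasDerivWithin_le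
    (f := fun s => f s - s * c) (f' := fun s => f' s - c) (C := C) (x := 0) (y := t)
    (fun s hs => by
      have h1 := ((hf s (hsub hs)).mono hsub).sub ((hasDerivWithinAt_id s _).mul_const c)
      rw [one_mul] at h1
      exact h1)
    (fun s hs => hC s (abs_le.mpr hs))
    ⟨by simp, abs_nonneg t⟩ (abs_le.mp le_rfl)
  simp only [Real.norm_eq_abs, zero_mul, sub_zero] at key
  convert key using 2
  ring

/-- Displacement and increment of `φ` along an integral curve of `D^φ_j` near `a₀`. -/
lemma integralCurve_estimates (hB : ∀ i, (B i).transpose = -B i) {U : Set (G m h)}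
    {φ : G m h → ℝ} {ω : G m h → Fin m → ℝ} {j : Fin m} {γ : ℝ → G m h} {a₀ : G m h}
    {δ t K η ε : ℝ} (ht : |t| ≤ δ)
    (hωj : ContinuousOn (fun w => ω w j) U)
    (hγU : ∀ s ∈ Set.Icc (-δ) δ, γ s ∈ U)
    (hγ : ∀ s ∈ Set.Icc (-δ) δ, HasDerivWithinAt γ (Dvec B φ j (γ s)) (Set.Icc (-δ) δ) s)
    (hγφ : ∀ s ∈ Set.Icc (-δ) δ, φ (γ s) - φ (γ 0) = ∫ r in (0 : ℝ)..s, ω (γ r) j)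
    (hK : 0 ≤ K) (hDK : ∀ w ∈ U, ‖w - a₀‖ < η → ‖Dvec B φ j w‖ < K)
    (hωε : ∀ w ∈ U, ‖w - a₀‖ < η → |ω w j - ω a₀ j| ≤ ε)
    (hη : ‖γ 0 - a₀‖ + K * |t| < η) :
    ‖γ t - a₀‖ ≤ ‖γ 0 - a₀‖ + K * |t| ∧
    (∀ k, (γ t).1 k = (γ 0).1 k + if k = j then t else 0) ∧
    |φ (γ t) - φ (γ 0) - ω a₀ j * t| ≤ ε * |t| ∧
    ∀ i, |(γ t).2 i - (γ 0).2 i + t * (B i j 0 * φ (γ 0)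
        + (1 / 2) * ∑ k ∈ Finset.univ.erase (0 : Fin m), (γ 0).1 k * B i j k)|
      ≤ |B i j 0| * (|ω a₀ j| + ε) * |t| ^ 2 := by
  have hmem : ∀ {s}, |s| ≤ |t| → s ∈ Set.Icc (-δ) δ := fun hs => abs_le.mp (hs.trans ht)
  have hdist : ∀ s, |s| ≤ |t| → ‖γ s - a₀‖ ≤ ‖γ 0 - a₀‖ + K * |s| := by
    intro s hs
    have := mul_le_mul_of_nonneg_left hs hK
    exact norm_sub_le_of_speed_lt (hmem hs) hγ (fun r hr => hDK _ (hγU r hr)) hK (by linarith)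
  have hnear : ∀ s, |s| ≤ |t| → ‖γ s - a₀‖ < η := by
    intro s hs
    have := mul_le_mul_of_nonneg_left hs hK
    linarith [hdist s hs]
  have hhor : ∀ s, |s| ≤ |t| → ∀ k, (γ s).1 k = (γ 0).1 k + if k = j then s else 0 := by
    intro s hs k
    have h1 := abs_sub_sub_mul_le (f := fun s => (γ s).1 k) (c := if k = j then 1 else 0)
      (C := 0) (hs.trans ht)
      (fun r hr => (hasDerivWithinAt_pi.mp (hγ r hr).fst) k)
      (fun r _ => by simp [Dvec])
    rw [zero_mul] at h1
    have h2 := abs_nonpos_iff.mp h1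
    split_ifs at h2 ⊢ <;> linarith
  have hφ : ∀ s, |s| ≤ |t| → |φ (γ s) - φ (γ 0) - ω a₀ j * s| ≤ ε * |s| := by
    intro s hs
    have hsub : Set.uIcc 0 s ⊆ Set.Icc (-δ) δ := by
      refine Set.uIcc_subset_Icc (hmem (by simp)) (hmem hs)
    have hcont : ContinuousOn (fun r => ω (γ r) j) (Set.uIcc 0 s) :=
      hωj.comp (fun r hr => ((hγ r (hsub hr)).continuousWithinAt).mono hsub)
        (fun r hr => hγU r (hsub hr))
    have h1 : φ (γ s) - φ (γ 0) - ω a₀ j * s = ∫ r in (0 : ℝ)..s, (ω (γ r) j - ω a₀ j) := by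
      rw [intervalIntegral.integral_sub hcont.intervalIntegrable intervalIntegrable_const,
        hγφ s (hmem hs), intervalIntegral.integral_const]
      simp [mul_comm]
    have h2 := intervalIntegral.norm_integral_le_of_norm_le_const (a := 0) (b := s) (C := ε)
      (f := fun r => ω (γ r) j - ω a₀ j) (fun r hr => by
        have hr' : |r| ≤ |s| := by
          have := Set.abs_sub_left_of_mem_uIcc (Set.uIoc_subset_uIcc hr)
          simpa using this
        exact hωε _ (hγU r (hmem (hr'.trans hs))) (hnear r (hr'.trans hs)))
    rwa [← h1, sub_zero] at h2
  refine ⟨hdist t le_rfl, hhor t le_rfl, hφ t le_rfl, fun i => ?_⟩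
  have h1 := abs_sub_sub_mul_le (f := fun s => (γ s).2 i)
    (c := -(B i j 0 * φ (γ 0)
        + (1 / 2) * ∑ k ∈ Finset.univ.erase (0 : Fin m), (γ 0).1 k * B i j k))
    (C := |B i j 0| * (|ω a₀ j| + ε) * |t|) ht
    (fun r hr => (hasDerivWithinAt_pi.mp (hγ r hr).snd) i)
    (fun r hr => by
      have hsum : ∑ k ∈ Finset.univ.erase (0 : Fin m), (γ r).1 k * B i j k
          = ∑ k ∈ Finset.univ.erase (0 : Fin m), (γ 0).1 k * B i j k := by
        refine Finset.sum_congr rfl fun k _ => ?_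
        rw [hhor r hr k]
        split_ifs with hkj
        · have : B i j k = 0 := by
            rw [hkj]
            linarith [skew_apply hB i j j]
          simp [this]
        · simp
      have h2 : (Dvec B φ j (γ r)).2 i - -(B i j 0 * φ (γ 0)
          + (1 / 2) * ∑ k ∈ Finset.univ.erase (0 : Fin m), (γ 0).1 k * B i j k)
          = -(B i j 0 * (φ (γ r) - φ (γ 0))) := by
        simp only [Dvec, hsum]
        ring
      rw [h2, abs_neg, abs_mul, mul_assoc]
      refine mul_le_mul_of_nonneg_left ?_ (abs_nonneg _)
      have h3 : |φ (γ r) - φ (γ 0)| ≤ (|ω a₀ j| + ε) * |r| := by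
        have h4 := abs_add_le (φ (γ r) - φ (γ 0) - ω a₀ j * r) (ω a₀ j * r)
        rw [sub_add_cancel, abs_mul] at h4
        linarith [hφ r hr]
      have hε : 0 ≤ ε := (abs_nonneg _).trans (hωε _ (hγU 0 (hmem (by simp))) (hnear 0 (by simp)))
      exact h3.trans (mul_le_mul_of_nonneg_left hr (by positivity)))
  convert h1 using 1
  · congr 1
    ring
  · ring

/-- Concatenating integral curves of the fields `D^φ_j`, `j ∈ S`, moves the horizontal
coordinates of `a` in `S` to those of `b`, with controlled increments of the rest. -/
lemma exists_horizontal_path {U : Set (G m h)} {φ : G m h → ℝ} {a₀ a b : G m h}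
    {g : Fin m → ℝ} {K η ε Ω β : ℝ}
    (hstep : ∀ j, j ≠ 0 → ∀ c ∈ U, ∀ t : ℝ, ‖c - a₀‖ + K * |t| < η → ∃ c' ∈ U,
      ‖c' - a₀‖ ≤ ‖c - a₀‖ + K * |t| ∧
      (∀ k, c'.1 k = c.1 k + if k = j then t else 0) ∧
      |φ c' - φ c - g j * t| ≤ ε * |t| ∧
      ∀ i, |c'.2 i - c.2 i + t * (B i j 0 * φ c
          + (1 / 2) * ∑ k ∈ Finset.univ.erase (0 : Fin m), c.1 k * B i j k)|
        ≤ |B i j 0| * (|g j| + ε) * |t| ^ 2)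
    (hg : ∀ j, j ≠ 0 → |g j| + ε ≤ Ω) (hβ : ∀ i j k, |B i j k| ≤ β) (hβ0 : 0 ≤ β)
    (hε : 0 ≤ ε) (hΩ0 : 0 ≤ Ω) (hK : 0 ≤ K) (ha : a ∈ U) (S : Finset (Fin m)) (hS0 : (0 : Fin m) ∉ S)
    (hη : ‖a - a₀‖ + K * ∑ j ∈ S, |b.1 j - a.1 j| < η) :
    ∃ c ∈ U, ‖c - a₀‖ ≤ ‖a - a₀‖ + K * ∑ j ∈ S, |b.1 j - a.1 j| ∧
      (∀ k, c.1 k = if k ∈ S then b.1 k else a.1 k) ∧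
      |φ c - φ a - ∑ j ∈ S, g j * (b.1 j - a.1 j)| ≤ ε * ∑ j ∈ S, |b.1 j - a.1 j| ∧
      ∀ i, |c.2 i - a.2 i + ∑ j ∈ S, (B i j 0 * φ a * (b.1 j - a.1 j)
          + (1 / 2) * (b.1 j - a.1 j) * ∑ k ∈ Finset.univ.erase (0 : Fin m), a.1 k * B i j k)|
        ≤ β * (Ω + 1) * (∑ j ∈ S, |b.1 j - a.1 j|) ^ 2 := by
  induction S using Finset.induction_on with
  | empty => exact ⟨a, ha, by simp⟩
  | insert j S hjS ih =>
    have hj0 : j ≠ 0 := fun hj => hS0 (hj ▸ Finset.mem_insert_self j S)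
    rw [Finset.sum_insert hjS] at hη
    set t := b.1 j - a.1 j with ht
    set s := ∑ j ∈ S, |b.1 j - a.1 j| with hs
    have hs0 : 0 ≤ s := Finset.sum_nonneg fun _ _ => abs_nonneg _
    have ht0 : 0 ≤ |t| := abs_nonneg t
    have hKt : 0 ≤ K * |t| := by positivity
    obtain ⟨c, hcU, hc1, hc2, hc3, hc4⟩ := ih (fun h0 => hS0 (Finset.mem_insert_of_mem h0))
      (by linarith)
    obtain ⟨c', hcU', hd1, hd2, hd3, hd4⟩ := hstep j hj0 c hcU t (by linarith)
    refine ⟨c', hcU', ?_, ?_, ?_, ?_⟩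
    · rw [Finset.sum_insert hjS]
      linarith
    · intro k
      rw [hd2 k, hc2 k]
      by_cases hkj : k = j
      · subst hkj
        simp [hjS, ht]
      · simp [hkj]
    · rw [Finset.sum_insert hjS, Finset.sum_insert hjS]
      have := abs_add_le (φ c' - φ c - g j * t)
        (φ c - φ a - ∑ j ∈ S, g j * (b.1 j - a.1 j))
      calc _ = |(φ c' - φ c - g j * t)
              + (φ c - φ a - ∑ j ∈ S, g j * (b.1 j - a.1 j))| := by congr 1; ring
        _ ≤ _ := by linarith
    · intro i
      rw [Finset.sum_insert hjS, Finset.sum_insert hjS]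
      have hφca : |φ c - φ a| ≤ Ω * s := by
        have h1 : |∑ j ∈ S, g j * (b.1 j - a.1 j)| ≤ ∑ j ∈ S, (Ω - ε) * |b.1 j - a.1 j| := by
          refine (Finset.abs_sum_le_sum_abs _ _).trans (Finset.sum_le_sum fun l hl => ?_)
          rw [abs_mul]
          have hl0 : l ≠ 0 := fun h0 => hS0 (h0 ▸ Finset.mem_insert_of_mem hl)
          exact mul_le_mul_of_nonneg_right (by linarith [hg l hl0]) (abs_nonneg _)
        rw [← Finset.mul_sum] at h1
        have h2 := abs_add_le (φ c - φ a - ∑ j ∈ S, g j * (b.1 j - a.1 j))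
          (∑ j ∈ S, g j * (b.1 j - a.1 j))
        rw [sub_add_cancel] at h2
        linarith
      have hsum : |∑ k ∈ Finset.univ.erase (0 : Fin m), (c.1 k - a.1 k) * B i j k| ≤ β * s := by
        have hsub : S ⊆ Finset.univ.erase (0 : Fin m) := fun l hl =>
          Finset.mem_erase.mpr
            ⟨fun h0 => hS0 (h0 ▸ Finset.mem_insert_of_mem hl), Finset.mem_univ l⟩
        rw [← Finset.sum_subset hsub (fun k _ hk => by simp [hc2 k, hk]), hs, Finset.mul_sum]
        refine (Finset.abs_sum_le_sum_abs _ _).trans (Finset.sum_le_sum fun k hk => ?_)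
        rw [abs_mul, hc2 k, if_pos hk, mul_comm]
        exact mul_le_mul_of_nonneg_right (hβ i j k) (abs_nonneg _)
      have hquad : |c'.2 i - c.2 i + t * (B i j 0 * φ c
          + (1 / 2) * ∑ k ∈ Finset.univ.erase (0 : Fin m), c.1 k * B i j k)|
          ≤ β * Ω * |t| ^ 2 := by
        refine (hd4 i).trans (mul_le_mul_of_nonneg_right ?_ (by positivity))
        exact mul_le_mul (hβ i j 0) (hg j hj0)
          (by linarith [abs_nonneg (g j)]) hβ0
      have hcross : |t * B i j 0 * (φ c - φ a)| ≤ |t| * β * (Ω * s) := by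
        rw [abs_mul, abs_mul]
        exact mul_le_mul (mul_le_mul_of_nonneg_left (hβ i j 0) ht0) hφca (abs_nonneg _)
          (by positivity)
      have hcross' : |(1 / 2) * t
          * ∑ k ∈ Finset.univ.erase (0 : Fin m), (c.1 k - a.1 k) * B i j k|
          ≤ (1 / 2) * |t| * (β * s) := by
        rw [abs_mul, abs_mul, abs_of_pos (by norm_num : (0 : ℝ) < 1 / 2)]
        exact mul_le_mul_of_nonneg_left hsum (by positivity)
      have hsplit : ∑ k ∈ Finset.univ.erase (0 : Fin m), (c.1 k - a.1 k) * B i j k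
          = ∑ k ∈ Finset.univ.erase (0 : Fin m), c.1 k * B i j k
            - ∑ k ∈ Finset.univ.erase (0 : Fin m), a.1 k * B i j k := by
        rw [← Finset.sum_sub_distrib]
        exact Finset.sum_congr rfl fun k _ => by ring
      have hfin : β * (Ω + 1) * s ^ 2 + β * Ω * |t| ^ 2 + |t| * β * (Ω * s)
          + (1 / 2) * |t| * (β * s) ≤ β * (Ω + 1) * (|t| + s) ^ 2 := by
        have h1 : 0 ≤ β * |t| ^ 2 := by positivity
        have h2 : 0 ≤ β * Ω * (|t| * s) := by positivity
        have h3 : 0 ≤ β * (|t| * s) := by positivity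
        nlinarith
      refine le_trans ?_ hfin
      have hc4i := hc4 i
      rw [hsplit] at hcross'
      have hdecomp : ∀ X c'i ci ai Bj Sc Sa : ℝ,
          c'i - ai + ((Bj * φ a * t + (1 / 2) * t * Sa) + X)
            = (c'i - ci + t * (Bj * φ c + (1 / 2) * Sc)) + (ci - ai + X)
              - t * Bj * (φ c - φ a) - (1 / 2) * t * (Sc - Sa) := by
        intros
        ring
      rw [hdecomp _ _ (c.2 i) _ _
        (∑ k ∈ Finset.univ.erase (0 : Fin m), c.1 k * B i j k)]
      refine (abs_sub _ _).trans ?_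
      refine (add_le_add_left ((abs_sub _ _).trans (add_le_add_left (abs_add_le _ _) _)) _).trans ?_
      linarith

/-- Changing the vertical coordinates one at a time. -/
lemma abs_sub_le_sum_sqrt {φ : G m h → ℝ} {a₀ c b : G m h} {η ε : ℝ}
    (hV : ∀ i, ∀ p ∈ Wset m h, ∀ q ∈ Wset m h, ‖p - a₀‖ < η → ‖q - a₀‖ < η → p.1 = q.1 →
      (∀ i', i' ≠ i → p.2 i' = q.2 i') → |φ p - φ q| ≤ ε * Real.sqrt |p.2 i - q.2 i|)
    (hc : c ∈ Wset m h) (hcb : c.1 = b.1) (hcη : ‖c - a₀‖ < η) (hbη : ‖b - a₀‖ < η) :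
    |φ b - φ c| ≤ ε * ∑ i, Real.sqrt |b.2 i - c.2 i| := by
  classical
  let q : Finset (Fin h) → G m h := fun S => (c.1, fun i => if i ∈ S then b.2 i else c.2 i)
  have hη : 0 < η := (norm_nonneg _).trans_lt hcη
  have hq : ∀ S, ‖q S - a₀‖ < η := by
    intro S
    rw [Prod.norm_def, max_lt_iff] at hcη hbη ⊢
    refine ⟨hcη.1, (pi_norm_lt_iff hη).mpr fun i => ?_⟩
    by_cases hi : i ∈ S
    · simpa [q, hi] using (pi_norm_lt_iff hη).mp hbη.2 i
    · simpa [q, hi] using (pi_norm_lt_iff hη).mp hcη.2 i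
  have key : ∀ S : Finset (Fin h), |φ (q S) - φ c| ≤ ε * ∑ i ∈ S, Real.sqrt |b.2 i - c.2 i| := by
    intro S
    induction S using Finset.induction_on with
    | empty => simp [q]
    | insert i S hi ih =>
      have h1 := hV i (q (insert i S)) hc (q S) hc (hq _) (hq _) rfl
        (fun i' hi' => by simp [q, hi'])
      have h2 : (q (insert i S)).2 i - (q S).2 i = b.2 i - c.2 i := by simp [q, hi]
      rw [h2] at h1
      rw [Finset.sum_insert hi, mul_add]
      linarith [abs_sub_le (φ (q (insert i S))) (φ (q S)) (φ c)]
  have hlast : q Finset.univ = b := by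
    ext i <;> simp [q, hcb]
  simpa [hlast] using key Finset.univ

lemma continuousOn_Dvec {U : Set (G m h)} {φ : G m h → ℝ} (hφ : ContinuousOn φ U) (j : Fin m) :
    ContinuousOn (Dvec B φ j) U := by
  unfold Dvec
  fun_prop

lemma RelOpen.eventually_mem {U : Set (G m h)} (hU : RelOpen m h U) {a₀ : G m h} (ha₀ : a₀ ∈ U) :
    ∀ᶠ w in 𝓝 a₀, w ∈ Wset m h → w ∈ U := by
  obtain ⟨O, hO, rfl⟩ := hU
  filter_upwards [hO.mem_nhds ha₀.1] with w hw hwW using ⟨hw, hwW⟩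

/-- Near `a₀`, vertical displacements of one coordinate satisfy the little Hölder estimate. -/
lemma VertHolder.exists_radius {U : Set (G m h)} {φ : G m h → ℝ} (hφ : VertHolder m h U φ)
    {a₀ : G m h} (ha₀ : a₀ ∈ U) {ε : ℝ} (hε : 0 < ε) :
    ∀ᶠ η in 𝓝[>] (0 : ℝ), ∀ i, ∀ p ∈ Wset m h, ∀ q ∈ Wset m h,
      ‖p - a₀‖ < η → ‖q - a₀‖ < η → p.1 = q.1 →
      (∀ i', i' ≠ i → p.2 i' = q.2 i') → |φ p - φ q| ≤ ε * Real.sqrt |p.2 i - q.2 i| := by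
  obtain ⟨U', hU', haU', -, -, hH⟩ := hφ a₀ ha₀
  obtain ⟨η', hη', hball⟩ := Metric.eventually_nhds_iff.mp (hU'.eventually_mem haU')
  rw [eventually_all]
  intro i
  obtain ⟨ρ, hρ, hHρ⟩ := hH i ε hε
  have hpos : 0 < min η' (ρ / 2) := lt_min hη' (half_pos hρ)
  filter_upwards [Ioo_mem_nhdsGT hpos] with η hη p hp q hq hpη hqη hpq hpq'
  have hη1 : η < η' := hη.2.trans_le (min_le_left _ _)
  have hη2 : η < ρ / 2 := hη.2.trans_le (min_le_right _ _)
  rcases eq_or_ne (p.2 i) (q.2 i) with heq | hne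
  · have : p = q := by
      refine Prod.ext hpq (funext fun i' => ?_)
      by_cases hi' : i' = i
      · rw [hi', heq]
      · exact hpq' i' hi'
    simp [this]
  · refine hHρ p (hball (by rw [dist_eq_norm]; linarith) hp) q
      (hball (by rw [dist_eq_norm]; linarith) hq) hpq hpq' (abs_pos.mpr (sub_ne_zero.mpr hne)) ?_
    have h1 : ‖(p - q).2 i‖ ≤ ‖p - q‖ := (norm_le_pi_norm _ i).trans (norm_snd_le _)
    have h2 : ‖p - q‖ ≤ ‖p - a₀‖ + ‖q - a₀‖ := by
      have := norm_sub_le (p - a₀) (q - a₀)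
      rwa [sub_sub_sub_cancel_right] at this
    have h3 : ‖(p - q).2 i‖ = |p.2 i - q.2 i| := rfl
    linarith

/-- Near `a₀` one may move along an integral curve of every field `D^φ_j`, with `K` an upper
bound for its speed. -/
lemma IsBroadStar.exists_radius (hB : ∀ i, (B i).transpose = -B i) {U : Set (G m h)}
    {φ : G m h → ℝ} (hφ : ContinuousOn φ U) {ω : G m h → Fin m → ℝ}
    (hω : ∀ j : Fin m, j ≠ 0 → ContinuousOn (fun w => ω w j) U)
    (hbroad : IsBroadStar B U φ ω) {a₀ : G m h} (ha₀ : a₀ ∈ U) {ε : ℝ} (hε : 0 < ε) :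
    ∃ K > (0 : ℝ), ∀ᶠ η in 𝓝[>] (0 : ℝ), ∀ j, j ≠ 0 → ∀ c ∈ U, ∀ t : ℝ,
      ‖c - a₀‖ + K * |t| < η → ∃ c' ∈ U,
      ‖c' - a₀‖ ≤ ‖c - a₀‖ + K * |t| ∧
      (∀ k, c'.1 k = c.1 k + if k = j then t else 0) ∧
      |φ c' - φ c - ω a₀ j * t| ≤ ε * |t| ∧
      ∀ i, |c'.2 i - c.2 i + t * (B i j 0 * φ c
          + (1 / 2) * ∑ k ∈ Finset.univ.erase (0 : Fin m), c.1 k * B i j k)|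
        ≤ |B i j 0| * (|ω a₀ j| + ε) * |t| ^ 2 := by
  obtain ⟨δ₁, δ, hδ, -, hE⟩ := hbroad a₀ ha₀
  set K : ℝ := ∑ j, ‖Dvec B φ j a₀‖ + 1
  have hK : 0 < K := by positivity
  have hK' : ∀ j, ‖Dvec B φ j a₀‖ < K := fun j => by
    have := Finset.single_le_sum (f := fun j => ‖Dvec B φ j a₀‖)
      (fun j _ => norm_nonneg _) (Finset.mem_univ j)
    linarith
  have hD : ∀ᶠ w in 𝓝 a₀, ∀ j, w ∈ U → ‖Dvec B φ j w‖ < K := by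
    rw [eventually_all]
    intro j
    exact eventually_nhdsWithin_iff.mp
      (((continuousOn_Dvec hφ j) a₀ ha₀).norm.eventually_lt continuousWithinAt_const (hK' j))
  have hωn : ∀ᶠ w in 𝓝 a₀, ∀ j, j ≠ 0 → w ∈ U → |ω w j - ω a₀ j| ≤ ε := by
    rw [eventually_all]
    intro j
    rw [eventually_imp_distrib_left]
    intro hj
    refine eventually_nhdsWithin_iff.mp ?_
    filter_upwards [Metric.tendsto_nhds.mp (hω j hj a₀ ha₀) ε hε] with w hw
    exact hw.le
  have hd : ∀ᶠ w in 𝓝 a₀, eDist w a₀ < δ := by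
    refine (continuous_eDist_left a₀).continuousAt.eventually_lt continuousAt_const ?_
    simpa [eDist] using hδ
  obtain ⟨η', hη', hball⟩ := Metric.eventually_nhds_iff.mp (hD.and (hωn.and hd))
  refine ⟨K, hK, ?_⟩
  filter_upwards [Ioo_mem_nhdsGT (lt_min hη' (mul_pos hK hδ))] with η hη j hj c hc t hct
  have hη1 : η < η' := hη.2.trans_le (min_le_left _ _)
  have hη2 : η < K * δ := hη.2.trans_le (min_le_right _ _)
  have hnear : ∀ {w}, ‖w - a₀‖ < η → dist w a₀ < η' := fun hw => by
    rw [dist_eq_norm]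
    linarith
  have hcη : ‖c - a₀‖ < η := by
    have : 0 ≤ K * |t| := by positivity
    linarith
  have ht : |t| ≤ δ := by
    have : K * |t| < K * δ := by linarith [norm_nonneg (c - a₀)]
    exact (lt_of_mul_lt_mul_left this hK.le).le
  obtain ⟨E, hE⟩ := hE j hj
  obtain ⟨hE1, hE2, hE3, hE4⟩ := hE c hc (hball (hnear hcη)).2.2.le
  have hest := integralCurve_estimates hB (γ := E c) (a₀ := a₀) (η := η) (K := K) (ε := ε) ht
    (hω j hj) (fun s hs => (hE1 s hs).1) hE3 (by rwa [hE2]) hK.le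
    (fun w hw hwη => (hball (hnear hwη)).1 j hw)
    (fun w hw hwη => (hball (hnear hwη)).2.1 j hj hw) (by rwa [hE2])
  rw [hE2] at hest
  exact ⟨E c t, (hE1 t (abs_le.mp ht)).1, hest⟩

/-- If `φ` is vertically broad* Hölder on `U` and `D^φφ = ω` in the broad*
sense for some continuous `ω : U → ℝ^(m-1)`, then `φ ∈ UID(U)` and `∇^φφ = ω` on `U`. -/
theorem statement8 (m h : ℕ) [NeZero m] (hm : 2 ≤ m) (hh : 1 ≤ h)
    (B : Fin h → Matrix (Fin m) (Fin m) ℝ)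
    (hskew : ∀ i, (B i).transpose = - B i) (hBli : LinearIndependent ℝ B)
    (U : Set (G m h)) (hUW : U ⊆ Wset m h) (hUopen : RelOpen m h U)
    (φ : G m h → ℝ) (hφ : ContinuousOn φ U)
    (hvert : VertHolder m h U φ)
    (ω : G m h → Fin m → ℝ)
    (hω : ∀ j : Fin m, j ≠ 0 → ContinuousOn (fun w => ω w j) U)
    (hbroad : IsBroadStar B U φ ω) :
    ∀ a₀ ∈ U, UIDAt B U φ a₀ (ω a₀) := by
  intro a₀ ha₀ ε hε
  set Ω : ℝ := ∑ j, |ω a₀ j| + 1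
  set β : ℝ := ∑ i, ∑ j, ∑ k, |B i j k|
  have hΩ0 : 0 ≤ Ω := by positivity
  have hβ0 : 0 ≤ β := by positivity
  have hβ : ∀ i j k, |B i j k| ≤ β := fun i j k =>
    calc |B i j k| ≤ ∑ k, |B i j k| :=
          Finset.single_le_sum (f := fun k => |B i j k|) (fun _ _ => abs_nonneg _)
            (Finset.mem_univ k)
      _ ≤ ∑ j, ∑ k, |B i j k| :=
          Finset.single_le_sum (f := fun j => ∑ k, |B i j k|)
            (fun _ _ => Finset.sum_nonneg fun _ _ => abs_nonneg _) (Finset.mem_univ j)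
      _ ≤ β :=
          Finset.single_le_sum (f := fun i => ∑ j, ∑ k, |B i j k|)
            (fun _ _ => Finset.sum_nonneg fun _ _ => Finset.sum_nonneg fun _ _ => abs_nonneg _)
            (Finset.mem_univ i)
  set C : ℝ := β * (Ω + 1) with hC
  have hC0 : 0 ≤ C := by positivity
  set M : ℝ := 1 + h * Real.sqrt C with hM
  have hM1 : 1 ≤ M := by
    have : 0 ≤ h * Real.sqrt C := by positivity
    linarith
  set ε' : ℝ := min 1 (ε / M)
  have hε' : 0 < ε' := lt_min one_pos (by positivity)
  have hε'M : ε' * M ≤ ε := by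
    have : ε' ≤ ε / M := min_le_right _ _
    rwa [le_div_iff₀ (by linarith)] at this
  have hg : ∀ j, j ≠ 0 → |ω a₀ j| + ε' ≤ Ω := fun j _ => by
    have h1 := Finset.single_le_sum (f := fun j => |ω a₀ j|) (fun j _ => abs_nonneg _)
      (Finset.mem_univ j)
    exact add_le_add h1 (min_le_left _ _)
  obtain ⟨K, hK, hKη⟩ := hbroad.exists_radius hskew hφ hω ha₀ hε'
  obtain ⟨η, ⟨hstep, hV⟩, hη⟩ :=
    ((hKη.and (hvert.exists_radius ha₀ hε')).and self_mem_nhdsWithin).exists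
  replace hη : 0 < η := hη
  set η₁ : ℝ := η / (1 + 2 * K * m) with hη₁
  have hden : 1 ≤ 1 + 2 * K * m := by
    have : 0 ≤ 2 * K * m := by positivity
    linarith
  have hη₁0 : 0 < η₁ := by positivity
  have hη₁η : η₁ ≤ η := div_le_self hη.le hden
  have hη₁' : η₁ + K * (m * (2 * η₁)) = η := by
    rw [hη₁]
    field_simp
  obtain ⟨r, hr, hrη⟩ := exists_gdist_lt_imp hskew a₀ hη₁0
  refine ⟨r, hr, fun a ha b hb har hbr _ => ?_⟩
  have haη := hrη a har
  have hbη := hrη b hbr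
  set s := ∑ j ∈ Finset.univ.erase (0 : Fin m), |b.1 j - a.1 j| with hs
  have hs0 : 0 ≤ s := Finset.sum_nonneg fun _ _ => abs_nonneg _
  have hsall : ∑ j, |b.1 j - a.1 j| = s := by
    rw [← Finset.add_sum_erase Finset.univ _ (Finset.mem_univ (0 : Fin m)),
      show a.1 0 = 0 from hUW ha, show b.1 0 = 0 from hUW hb]
    simp [hs]
  have hs2 : s ≤ m * (2 * η₁) := by
    rw [← hsall]
    refine (Finset.sum_le_card_nsmul _ _ (2 * η₁) fun j _ => ?_).trans (by simp)
    have h1 : ‖(b - a).1 j‖ ≤ ‖b - a‖ := (norm_le_pi_norm _ j).trans (norm_fst_le _)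
    have h2 : ‖b - a‖ ≤ ‖b - a₀‖ + ‖a - a₀‖ := by
      have := norm_sub_le (b - a₀) (a - a₀)
      rwa [sub_sub_sub_cancel_right] at this
    have h3 : ‖(b - a).1 j‖ = |b.1 j - a.1 j| := rfl
    linarith
  have hpath : ‖a - a₀‖ + K * s < η := by
    have := mul_le_mul_of_nonneg_left hs2 hK.le
    linarith
  obtain ⟨c, hcU, hc1, hc2, hc3, hc4⟩ := exists_horizontal_path (b := b) hstep hg hβ hβ0 hε'.le
    hΩ0 hK.le ha (Finset.univ.erase 0) (Finset.notMem_erase _ _) hpath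
  have hcb : c.1 = b.1 := by
    ext k
    rw [hc2 k]
    by_cases hk : k = 0
    · subst hk
      simp [show a.1 0 = 0 from hUW ha, show b.1 0 = 0 from hUW hb]
    · simp [hk]
  have hbc := abs_sub_le_sum_sqrt hV (hUW hcU) hcb (hc1.trans_lt hpath)
    (hbη.trans_le hη₁η)
  have hsq : ∀ i, Real.sqrt |b.2 i - c.2 i|
      ≤ Real.sqrt |(shiftQ B φ a b).2 i| + Real.sqrt C * s := by
    intro i
    have h1 : |b.2 i - c.2 i| ≤ |(shiftQ B φ a b).2 i| + C * s ^ 2 := by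
      rw [shiftQ_snd hskew φ (hUW ha) (hUW hb)]
      refine le_trans ?_ (add_le_add_right (hc4 i) _)
      refine le_trans (le_of_eq ?_) (abs_sub _ _)
      congr 1
      ring
    refine Real.sqrt_le_iff.mpr ⟨by positivity, h1.trans ?_⟩
    have h2 : 0 ≤ Real.sqrt |(shiftQ B φ a b).2 i| * (Real.sqrt C * s) := by positivity
    rw [add_sq, mul_pow, Real.sq_sqrt (abs_nonneg _), Real.sq_sqrt hC0]
    linarith
  have hsum : ∑ i, Real.sqrt |b.2 i - c.2 i|
      ≤ ∑ i, Real.sqrt |(shiftQ B φ a b).2 i| + h * (Real.sqrt C * s) := by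
    refine (Finset.sum_le_sum fun i _ => hsq i).trans (le_of_eq ?_)
    simp [Finset.sum_add_distrib]
  have hnorm : hnorm (shiftQ B φ a b) = s + ∑ i, Real.sqrt |(shiftQ B φ a b).2 i| := by
    rw [hnorm, shiftQ_fst, ← hsall]
    rfl
  set z := ∑ i, Real.sqrt |(shiftQ B φ a b).2 i| with hz
  have hz0 : 0 ≤ z := Finset.sum_nonneg fun _ _ => Real.sqrt_nonneg _
  have htri := abs_add_le (φ b - φ c)
    (φ c - φ a - ∑ j ∈ Finset.univ.erase (0 : Fin m), ω a₀ j * (b.1 j - a.1 j))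
  rw [hnorm]
  calc _ = |(φ b - φ c) + (φ c - φ a
          - ∑ j ∈ Finset.univ.erase (0 : Fin m), ω a₀ j * (b.1 j - a.1 j))| := by
        congr 1
        ring
    _ ≤ ε' * (z + h * (Real.sqrt C * s)) + ε' * s :=
        htri.trans (add_le_add (hbc.trans (mul_le_mul_of_nonneg_left hsum hε'.le)) hc3)
    _ ≤ ε' * M * (s + z) := by
        rw [mul_assoc, ← mul_add]
        refine mul_le_mul_of_nonneg_left ?_ hε'.le
        rw [hM]
        have : 0 ≤ h * Real.sqrt C * z := by positivity
        linarith
    _ ≤ ε * (s + z) := mul_le_mul_of_nonneg_right hε'M (by positivity)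

end Step2
end

section
/- If φ is intrinsically differentiable at every point of U and the intrinsic gradient map a ↦ ∇^φφ(a) ∈ ℝ^{m−1} is continuous on U, then φ ∈ UID(U). -/
open MeasureTheory Filter Topology

namespace Step2

section Planar

/-- A continuous function that starts negative and is strictly decreasing through each of its zeros
stays negative. -/
lemma neg_of_deriv_neg_at_zeros {g : ℝ → ℝ} {T : ℝ} (hT : 0 ≤ T)
    (hg : ∀ t ∈ Set.Icc 0 T, ContinuousAt g t) (h0 : g 0 < 0)
    (hd : ∀ t ∈ Set.Icc 0 T, g t = 0 → ∃ d < 0, HasDerivAt g d t) : g T < 0 := by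
  by_contra! hgT
  have hc : ContinuousOn g (Set.Icc 0 T) := fun t ht => (hg t ht).continuousWithinAt
  set Z := Set.Icc 0 T ∩ g ⁻¹' Set.Ici 0 with hZ
  have hZc : IsCompact Z :=
    isCompact_Icc.of_isClosed_subset (hc.preimage_isClosed_of_isClosed isClosed_Icc isClosed_Ici)
      Set.inter_subset_left
  obtain ⟨t, ht, htl⟩ := hZc.exists_isLeast ⟨T, ⟨hT, le_rfl⟩, hgT⟩
  have hlt : ∀ s, 0 ≤ s → s < t → g s < 0 := by
    intro s hs hst
    by_contra! hgs
    exact absurd (htl ⟨⟨hs, hst.le.trans ht.1.2⟩, hgs⟩) (not_le.2 hst)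
  have htpos : 0 < t := by
    rcases ht.1.1.eq_or_lt with h | h
    · have := ht.2
      rw [← h] at this
      exact absurd h0 (not_lt.2 this)
    · exact h
  have hIoo : ∀ᶠ s in 𝓝[<] t, s ∈ Set.Ioo 0 t := Ioo_mem_nhdsLT htpos
  have hle : g t ≤ 0 :=
    le_of_tendsto ((hg t ht.1).tendsto.mono_left nhdsWithin_le_nhds)
      (hIoo.mono fun s hs => (hlt s hs.1.le hs.2).le)
  have hgt : g t = 0 := le_antisymm hle ht.2
  obtain ⟨d, hd0, hder⟩ := hd t ht.1 hgt
  have hslope := (hasDerivAt_iff_tendsto_slope_left_right.1 hder).1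
  refine absurd (ge_of_tendsto hslope (hIoo.mono fun s hs => ?_)) (not_le.2 hd0)
  rw [slope_def_field, hgt, sub_zero]
  exact div_nonneg_of_nonpos (hlt s hs.1.le hs.2).le (sub_nonpos.2 hs.2.le)

/-- `f` behaves at every point of the square `[-R, R]²` like a solution of the balance law
`∂ₜ f + f ∂ₛ f ∈ (c₁, c₂)`: it is differentiable along parabolas tangent to the
characteristics. -/
def IsPlanarSolution (f : ℝ → ℝ → ℝ) (R c₁ c₂ : ℝ) : Prop :=
  ∀ t s, |t| ≤ R → |s| ≤ R → ContinuousAt (fun z : ℝ × ℝ => f z.1 z.2) (t, s) ∧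
    ∃ d, c₁ < d ∧ d < c₂ ∧
      ∀ c, HasDerivAt (fun r => f r (s + f t s * (r - t) + c * (r - t) ^ 2)) d t

variable {f : ℝ → ℝ → ℝ} {R c₁ c₂ : ℝ}

lemma IsPlanarSolution.time_reversal (hf : IsPlanarSolution f R c₁ c₂) :
    IsPlanarSolution (fun t s => f (-t) (-s)) R (-c₂) (-c₁) := by
  intro t s ht hs
  obtain ⟨hc, d, h1, h2, hd⟩ := hf (-t) (-s) (by rwa [abs_neg]) (by rwa [abs_neg])
  refine ⟨?_, -d, by linarith, by linarith, fun c => ?_⟩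
  · exact ContinuousAt.comp (f := fun z : ℝ × ℝ => (-z.1, -z.2)) (x := (t, s)) hc
      (by fun_prop)
  · have := (hd (-c)).comp t (hasDerivAt_neg t)
    simp only [mul_neg, mul_one] at this
    refine this.congr_of_eventuallyEq (Eventually.of_forall fun r => ?_)
    simp only [Function.comp]
    congr 1
    ring

lemma IsPlanarSolution.reflect (hf : IsPlanarSolution f R c₁ c₂) :
    IsPlanarSolution (fun t s => -f t (-s)) R (-c₂) (-c₁) := by
  intro t s ht hs
  obtain ⟨hc, d, h1, h2, hd⟩ := hf t (-s) ht (by rwa [abs_neg])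
  refine ⟨?_, -d, by linarith, by linarith, fun c => ?_⟩
  · exact (ContinuousAt.comp (f := fun z : ℝ × ℝ => (z.1, -z.2)) (x := (t, s)) hc
      (by fun_prop)).neg
  · refine (hd (-c)).neg.congr_of_eventuallyEq (Eventually.of_forall fun r => ?_)
    simp only [Pi.neg_apply]
    congr 2
    ring

/-- Parabolas with acceleration `c₂` are barriers from above. -/
lemma IsPlanarSolution.lt_of_parabola (hf : IsPlanarSolution f R c₁ c₂) {s v T : ℝ} (hT : 0 ≤ T)
    (hTR : T ≤ R) (hR : ∀ t ∈ Set.Icc 0 T, |s + v * t + c₂ / 2 * t ^ 2| ≤ R) (h0 : f 0 s < v) :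
    f T (s + v * T + c₂ / 2 * T ^ 2) < v + c₂ * T := by
  have habs : ∀ t ∈ Set.Icc 0 T, |t| ≤ R := fun t ht => by
    rw [abs_of_nonneg ht.1]; exact ht.2.trans hTR
  have := neg_of_deriv_neg_at_zeros
    (g := fun t => f t (s + v * t + c₂ / 2 * t ^ 2) - (v + c₂ * t)) hT ?_ (by simpa using h0) ?_
  · linarith
  · intro t ht
    refine ContinuousAt.sub ?_ (by fun_prop)
    exact ContinuousAt.comp (f := fun t : ℝ => (t, s + v * t + c₂ / 2 * t ^ 2)) (x := t)
      (hf t _ (habs t ht) (hR t ht)).1 (by fun_prop)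
  · intro t ht hzero
    obtain ⟨-, d, -, h2, hd⟩ := hf t _ (habs t ht) (hR t ht)
    refine ⟨d - c₂, by linarith, ?_⟩
    have hv : f t (s + v * t + c₂ / 2 * t ^ 2) = v + c₂ * t := by linarith
    refine HasDerivAt.sub ?_ ?_
    · refine (hd (c₂ / 2)).congr_of_eventuallyEq (Eventually.of_forall fun r => ?_)
      simp only [hv]
      congr 1
      ring
    · simpa using ((hasDerivAt_id t).const_mul c₂).const_add v

/-- Parabolas with acceleration `c₁` are barriers from below. -/
lemma IsPlanarSolution.gt_of_parabola (hf : IsPlanarSolution f R c₁ c₂) {s v T : ℝ} (hT : 0 ≤ T)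
    (hTR : T ≤ R) (hR : ∀ t ∈ Set.Icc 0 T, |s + v * t + c₁ / 2 * t ^ 2| ≤ R) (h0 : v < f 0 s) :
    v + c₁ * T < f T (s + v * T + c₁ / 2 * T ^ 2) := by
  have := hf.reflect.lt_of_parabola (s := -s) (v := -v) hT hTR
    (fun t ht => by
      rw [← abs_neg]
      convert hR t ht using 2
      ring) (by simpa using h0)
  have h2 : -(-s + -v * T + -c₁ / 2 * T ^ 2) = s + v * T + c₁ / 2 * T ^ 2 := by ring
  rw [h2] at this
  linarith

lemma abs_parabola_le {s v c K S T t : ℝ} (hs : |s| ≤ S) (hv : |v| ≤ K) (hc : |c| ≤ K)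
    (ht : t ∈ Set.Icc 0 T) : |s + v * t + c / 2 * t ^ 2| ≤ S + K * T + K * T ^ 2 := by
  have hK : 0 ≤ K := (abs_nonneg v).trans hv
  have h1 : |v * t| ≤ K * T := by
    rw [abs_mul, abs_of_nonneg ht.1]
    exact mul_le_mul hv ht.2 ht.1 hK
  have h2 : |c / 2 * t ^ 2| ≤ K * T ^ 2 := by
    rw [abs_mul, abs_of_nonneg (sq_nonneg t), abs_div, abs_two]
    have : |c| / 2 ≤ K := by linarith [abs_nonneg c]
    exact mul_le_mul this (pow_le_pow_left₀ ht.1 ht.2 2) (sq_nonneg t) hK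
  linarith [abs_add_le (s + v * t) (c / 2 * t ^ 2), abs_add_le s (v * t)]

/-- Characteristics issued from `(0, 0)` and `(0, s)` cannot cross too early, whence a one-sided
Hölder bound. -/
lemma IsPlanarSolution.sub_le (hf : IsPlanarSolution f R c₁ c₂) {s K T c : ℝ} (hT : 0 ≤ T)
    (hc : 0 < c) (hcc : c₂ - c₁ = 2 * c) (hs : 0 ≤ s) (hsT : s ≤ c * T ^ 2) (hc₁ : |c₁| ≤ K)
    (hc₂ : |c₂| ≤ K) (hf0 : |f 0 0| ≤ K) (hfs : |f 0 s| ≤ K) (hTR : T ≤ R)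
    (hKR : s + K * T + K * T ^ 2 ≤ R) : f 0 0 - f 0 s ≤ 2 * c * T := by
  obtain ⟨r, hr0, hrT, hr⟩ : ∃ r, 0 ≤ r ∧ r ≤ T ∧ s = c * r ^ 2 := by
    refine ⟨√(s / c), Real.sqrt_nonneg _, ?_, ?_⟩
    · rw [Real.sqrt_le_left hT, div_le_iff₀ hc]
      linarith
    · rw [Real.sq_sqrt (by positivity)]
      field_simp
  by_contra! hlt
  have hrc : 2 * c * r ≤ 2 * c * T := by gcongr
  set e := (f 0 0 - f 0 s - 2 * c * r) / 2 with he
  have he0 : 0 < e := by rw [he]; linarith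
  have hcr : 0 ≤ 2 * c * r := by positivity
  rw [abs_le] at hf0 hfs
  have hsub : ∀ t ∈ Set.Icc 0 r, t ∈ Set.Icc 0 T := fun t ht => ⟨ht.1, ht.2.trans hrT⟩
  have hup := hf.lt_of_parabola (s := s) (v := f 0 s + e) hr0 (hrT.trans hTR)
    (fun t ht => (abs_parabola_le (abs_of_nonneg hs).le (abs_le.2 ⟨by linarith, by linarith⟩) hc₂
      (hsub t ht)).trans hKR) (by linarith)
  have hlo := hf.gt_of_parabola (s := 0) (v := f 0 0 - e) hr0 (hrT.trans hTR)
    (fun t ht => (abs_parabola_le (abs_zero.trans_le hs) (abs_le.2 ⟨by linarith, by linarith⟩) hc₁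
      (hsub t ht)).trans hKR) (by linarith)
  have hmeet : s + (f 0 s + e) * r + c₂ / 2 * r ^ 2 = 0 + (f 0 0 - e) * r + c₁ / 2 * r ^ 2 := by
    rw [hr, show c₂ = c₁ + 2 * c by linarith, he]
    rw [hr]
    ring
  rw [hmeet] at hup
  have : c₂ * r = c₁ * r + 2 * c * r := by rw [show c₂ = c₁ + 2 * c by linarith]; ring
  linarith

lemma IsPlanarSolution.abs_sub_le (hf : IsPlanarSolution f R c₁ c₂) {s K T c : ℝ} (hT : 0 ≤ T)
    (hc : 0 < c) (hcc : c₂ - c₁ = 2 * c) (hsT : |s| ≤ c * T ^ 2) (hc₁ : |c₁| ≤ K)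
    (hc₂ : |c₂| ≤ K) (hfK : ∀ s', |s'| ≤ R → |f 0 s'| ≤ K) (hTR : T ≤ R)
    (hKR : |s| + K * T + K * T ^ 2 ≤ R) : |f 0 s - f 0 0| ≤ 2 * c * T := by
  have hhalf : ∀ {g : ℝ → ℝ → ℝ} {d₁ d₂ : ℝ}, IsPlanarSolution g R d₁ d₂ → d₂ - d₁ = 2 * c →
      |d₁| ≤ K → |d₂| ≤ K → (∀ s', |s'| ≤ R → |g 0 s'| ≤ K) → g 0 0 - g 0 |s| ≤ 2 * c * T := by
    intro g d₁ d₂ hg hd h1 h2 hgK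
    have hK : 0 ≤ K := (abs_nonneg _).trans h1
    have hsR : |s| ≤ R := by nlinarith [mul_nonneg hK hT, mul_nonneg hK (sq_nonneg T)]
    exact hg.sub_le hT hc hd (abs_nonneg s) hsT h1 h2
      (hgK 0 (abs_zero.trans_le (hT.trans hTR))) (hgK _ ((abs_abs s).trans_le hsR)) hTR hKR
  have a1 := hhalf hf hcc hc₁ hc₂ hfK
  have a2 := hhalf hf.time_reversal (by linarith) (by rwa [abs_neg]) (by rwa [abs_neg])
    (fun s' hs' => by simpa using hfK (-s') (by rwa [abs_neg]))
  have a3 := hhalf hf.reflect (by linarith) (by rwa [abs_neg]) (by rwa [abs_neg])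
    (fun s' hs' => by simpa using hfK (-s') (by rwa [abs_neg]))
  have a4 := hhalf hf.reflect.time_reversal (by linarith) (by rwa [neg_neg]) (by rwa [neg_neg])
    (fun s' hs' => by simpa using hfK s' hs')
  simp only [neg_zero, neg_neg] at a2 a3 a4
  rw [abs_le]
  rcases abs_choice s with h | h <;> simp only [h, neg_neg] at a1 a2 a3 a4 <;>
    constructor <;> linarith

end Planar

end Step2

namespace Step2

section Group

variable {m h : ℕ}

/-- The bilinear map `(x, u) ↦ ⟨Bx, u⟩`. -/
noncomputable def bil (B : Fin h → Matrix (Fin m) (Fin m) ℝ) :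
    (Fin m → ℝ) →ₗ[ℝ] (Fin m → ℝ) →ₗ[ℝ] (Fin h → ℝ) :=
  LinearMap.mk₂ ℝ (fun x u i => ∑ j, ∑ k, B i j k * x k * u j)
    (fun x x' u => by
      ext i
      simp only [Pi.add_apply, mul_add, add_mul, Finset.sum_add_distrib])
    (fun c x u => by
      ext i
      simp only [Pi.smul_apply, smul_eq_mul, Finset.mul_sum]
      exact Finset.sum_congr rfl fun j _ => Finset.sum_congr rfl fun k _ => by ring)
    (fun x u u' => by
      ext i
      simp only [Pi.add_apply, mul_add, Finset.sum_add_distrib])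
    (fun c x u => by
      ext i
      simp only [Pi.smul_apply, smul_eq_mul, Finset.mul_sum]
      exact Finset.sum_congr rfl fun j _ => Finset.sum_congr rfl fun k _ => by ring)

/-- The `ℓ¹` norm on the horizontal layer. -/
def l1 (u : Fin m → ℝ) : ℝ := ∑ j, |u j|

lemma l1_nonneg (u : Fin m → ℝ) : 0 ≤ l1 u := Finset.sum_nonneg fun _ _ => abs_nonneg _

lemma l1_pos {u : Fin m → ℝ} (hu : u ≠ 0) : 0 < l1 u := by
  obtain ⟨j, hj⟩ := Function.ne_iff.1 hu
  exact Finset.sum_pos' (fun _ _ => abs_nonneg _) ⟨j, Finset.mem_univ j, abs_pos.2 hj⟩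

lemma l1_smul (c : ℝ) (u : Fin m → ℝ) : l1 (c • u) = |c| * l1 u := by
  simp [l1, abs_mul, Finset.mul_sum]

lemma l1_add_le (u w : Fin m → ℝ) : l1 (u + w) ≤ l1 u + l1 w := by
  simp only [l1, ← Finset.sum_add_distrib]
  exact Finset.sum_le_sum fun j _ => abs_add_le _ _

lemma l1_single (j : Fin m) : l1 (Pi.single j (1 : ℝ)) = 1 := by
  rw [l1, Finset.sum_eq_single j (fun k _ hk => by simp [hk]) (by simp)]
  simp

lemma continuous_l1 : Continuous (l1 (m := m)) := by unfold l1; fun_prop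

variable {B : Fin h → Matrix (Fin m) (Fin m) ℝ}

lemma bil_apply (x u : Fin m → ℝ) (i : Fin h) :
    bil B x u i = ∑ j, ∑ k, B i j k * x k * u j := rfl

lemma bil_single_single (j k : Fin m) (i : Fin h) :
    bil B (Pi.single k 1) (Pi.single j 1) i = B i j k := by
  rw [bil_apply, Finset.sum_eq_single j (fun l _ hl => by simp [hl]) (by simp),
    Finset.sum_eq_single k (fun l _ hl => by simp [hl]) (by simp)]
  simp

@[fun_prop]
lemma continuous_bil {X : Type*} [TopologicalSpace X] {f g : X → Fin m → ℝ} (hf : Continuous f)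
    (hg : Continuous g) : Continuous fun z => bil B (f z) (g z) := by
  refine continuous_pi fun i => ?_
  simp only [bil_apply]
  fun_prop

lemma bil_swap (hskew : ∀ i, (B i).transpose = -B i) (x u : Fin m → ℝ) :
    bil B x u = -bil B u x := by
  ext i
  rw [Pi.neg_apply, bil_apply, bil_apply, Finset.sum_comm, ← Finset.sum_neg_distrib]
  refine Finset.sum_congr rfl fun k _ => ?_
  rw [← Finset.sum_neg_distrib]
  refine Finset.sum_congr rfl fun j _ => ?_
  have : B i j k = -B i k j := congrFun (congrFun (hskew i) k) j
  rw [this]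
  ring

lemma bil_self (hskew : ∀ i, (B i).transpose = -B i) (x : Fin m → ℝ) : bil B x x = 0 :=
  self_eq_neg.1 (bil_swap hskew x x)

lemma gmul_eq (p q : G m h) :
    gmul B p q = (p.1 + q.1, p.2 + q.2 - (1 / 2 : ℝ) • bil B p.1 q.1) := rfl

lemma hnorm_smul_sq_smul (u : Fin m → ℝ) (z : Fin h → ℝ) (c r : ℝ) :
    hnorm (r • u, (-(c * r ^ 2)) • z) = |r| * (l1 u + ∑ i, √|c * z i|) := by
  simp only [hnorm, Pi.smul_apply, smul_eq_mul, mul_add, l1, Finset.mul_sum, abs_mul]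
  congr 1
  refine Finset.sum_congr rfl fun i _ => ?_
  rw [abs_neg, abs_mul, mul_right_comm, abs_pow, mul_comm, Real.sqrt_mul (by positivity),
    Real.sqrt_sq (abs_nonneg r)]

lemma hnorm_zero : hnorm (0 : G m h) = 0 := by simp [hnorm]

lemma hnorm_nonneg (p : G m h) : 0 ≤ hnorm p :=
  add_nonneg (l1_nonneg _) (Finset.sum_nonneg fun _ _ => Real.sqrt_nonneg _)

lemma continuous_hnorm : Continuous (hnorm (m := m) (h := h)) := by unfold hnorm; fun_prop

lemma eq_zero_of_hnorm_eq_zero {p : G m h} (hp : hnorm p = 0) : p = 0 := by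
  have h1 : 0 ≤ ∑ i, √|p.2 i| := Finset.sum_nonneg fun _ _ => Real.sqrt_nonneg _
  have h2 : 0 ≤ ∑ j, |p.1 j| := l1_nonneg p.1
  unfold hnorm at hp
  refine Prod.ext ?_ ?_
  · ext j
    have := (Finset.sum_eq_zero_iff_of_nonneg fun _ _ => abs_nonneg _).1
      (show ∑ j, |p.1 j| = 0 by linarith) j (Finset.mem_univ j)
    simpa using this
  · ext i
    have := (Finset.sum_eq_zero_iff_of_nonneg fun _ _ => Real.sqrt_nonneg _).1
      (show ∑ i, √|p.2 i| = 0 by linarith) i (Finset.mem_univ i)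
    simpa using this

lemma gmul_gmul_ginv (hskew : ∀ i, (B i).transpose = -B i) (a b : G m h) :
    gmul B a (gmul B (ginv a) b) = b := by
  simp only [gmul_eq, ginv]
  refine Prod.ext (by simp) ?_
  simp only [map_add, map_neg, LinearMap.neg_apply, bil_self hskew]
  module

lemma continuous_gdist (a : G m h) : Continuous (gdist B a) := by
  refine continuous_hnorm.comp (g := hnorm) (f := fun b => gmul B (ginv a) b) ?_
  simp only [gmul_eq]
  fun_prop

lemma gdist_self (hskew : ∀ i, (B i).transpose = -B i) (a : G m h) : gdist B a a = 0 := by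
  have : gmul B (ginv a) a = 0 := by
    simp [gmul_eq, ginv, bil_self hskew]
  rw [gdist, this, hnorm_zero]

lemma eq_of_gdist_eq_zero (hskew : ∀ i, (B i).transpose = -B i) {a b : G m h}
    (hab : gdist B a b = 0) : b = a := by
  have := gmul_gmul_ginv hskew a b
  rw [eq_zero_of_hnorm_eq_zero hab] at this
  simpa [gmul_eq] using this.symm

variable [NeZero m]

lemma Phi_eq (φ : G m h → ℝ) (w : G m h) : Phi φ w = (φ w • Pi.single 0 1, 0) := by
  simp only [Phi, Prod.mk.injEq, and_true]
  ext j
  by_cases hj : j = 0 <;> simp [hj]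

lemma shiftQ_eq (hskew : ∀ i, (B i).transpose = -B i) (φ : G m h → ℝ) (a b : G m h) :
    shiftQ B φ a b = (b.1 - a.1, b.2 - a.2 + (1 / 2 : ℝ) • bil B a.1 (b.1 - a.1)
      + φ a • bil B (Pi.single 0 1) (b.1 - a.1)) := by
  simp only [shiftQ, gmul_eq, ginv, Phi_eq]
  refine Prod.ext (by simp only; abel) ?_
  simp only [map_add, map_sub, map_neg, map_smul, LinearMap.add_apply, LinearMap.neg_apply,
    LinearMap.smul_apply, bil_self hskew, bil_swap hskew _ (Pi.single 0 1)]
  module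

/-- The point reached from `p` by moving by `t • u` horizontally and by `-s • ⟨B e₁, u⟩`
vertically, relative to the left-invariant frame. -/
noncomputable def slicePoint (B : Fin h → Matrix (Fin m) (Fin m) ℝ) (p : G m h) (u : Fin m → ℝ)
    (t s : ℝ) : G m h :=
  (p.1 + t • u, p.2 - (t / 2) • bil B p.1 u - s • bil B (Pi.single 0 1) u)

@[fun_prop]
lemma continuous_slicePoint {X : Type*} [TopologicalSpace X] {p : X → G m h} {u : X → Fin m → ℝ}
    {t s : X → ℝ} (hp : Continuous p) (hu : Continuous u) (ht : Continuous t)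
    (hs : Continuous s) : Continuous fun z => slicePoint B (p z) (u z) (t z) (s z) := by
  unfold slicePoint
  fun_prop

lemma slicePoint_zero_right (p : G m h) (t s : ℝ) : slicePoint B p 0 t s = p := by
  simp [slicePoint]

lemma slicePoint_zero_left (p : G m h) (u : Fin m → ℝ) (s : ℝ) :
    slicePoint B p u 0 s = p + (0, (-s) • bil B (Pi.single 0 1) u) := by
  simp [slicePoint, Prod.ext_iff, sub_eq_add_neg]

lemma slicePoint_mem {p : G m h} {u : Fin m → ℝ} (hp : p ∈ Wset m h) (hu : u 0 = 0) (t s : ℝ) :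
    slicePoint B p u t s ∈ Wset m h := by
  have : p.1 0 = 0 := hp
  simp [slicePoint, Wset, hu, this]

lemma shiftQ_slicePoint (hskew : ∀ i, (B i).transpose = -B i) (φ : G m h → ℝ) (p : G m h)
    (u : Fin m → ℝ) (t s t' s' : ℝ) :
    shiftQ B φ (slicePoint B p u t s) (slicePoint B p u t' s') = ((t' - t) • u,
      (-(s' - s - φ (slicePoint B p u t s) * (t' - t))) • bil B (Pi.single 0 1) u) := by
  rw [shiftQ_eq hskew]
  generalize φ (slicePoint B p u t s) = c
  refine Prod.ext ?_ ?_
  · simp only [slicePoint]; module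
  · simp only [slicePoint, add_sub_add_left_eq_sub, ← sub_smul, map_add, map_smul,
      LinearMap.add_apply, LinearMap.smul_apply, bil_self hskew]
    module

lemma exists_gdist_lt_imp_mem (hskew : ∀ i, (B i).transpose = -B i) {a : G m h} {V : Set (G m h)}
    (hV : V ∈ 𝓝[Wset m h] a) : ∃ r > 0, ∀ b ∈ Wset m h, gdist B a b < r → b ∈ V := by
  obtain ⟨O, hO, ha, hOV⟩ := mem_nhdsWithin.1 hV
  have hc : Continuous fun z : G m h => gmul B a z := by
    simp only [gmul_eq]
    fun_prop
  have h0 : (fun z : G m h => gmul B a z) ⁻¹' O ∈ 𝓝 (0 : G m h) :=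
    hc.continuousAt.preimage_mem_nhds (hO.mem_nhds (by simpa [gmul_eq] using ha))
  obtain ⟨δ, hδ, hball⟩ := Metric.mem_nhds_iff.1 h0
  refine ⟨min δ (√δ), lt_min hδ (Real.sqrt_pos.2 hδ), fun b hb hab => hOV ⟨?_, hb⟩⟩
  rw [← gmul_gmul_ginv hskew a b]
  refine hball ?_
  rw [gdist] at hab
  generalize gmul B (ginv a) b = z at hab
  have h1 : 0 ≤ ∑ i, √|z.2 i| := Finset.sum_nonneg fun _ _ => Real.sqrt_nonneg _
  have h2 : 0 ≤ ∑ j, |z.1 j| := l1_nonneg z.1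
  obtain ⟨hl, hr⟩ := lt_min_iff.1 hab
  unfold hnorm at hl hr
  rw [mem_ball_zero_iff, Prod.norm_def, max_lt_iff, pi_norm_lt_iff hδ, pi_norm_lt_iff hδ]
  refine ⟨fun j => ?_, fun i => ?_⟩
  · have := Finset.single_le_sum (f := fun j => |z.1 j|) (fun _ _ => abs_nonneg _)
      (Finset.mem_univ j)
    exact this.trans_lt (by linarith)
  · have := Finset.single_le_sum (f := fun i => √|z.2 i|) (fun _ _ => Real.sqrt_nonneg _)
      (Finset.mem_univ i)
    exact lt_of_not_ge fun hge => absurd (Real.sqrt_le_sqrt hge)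
      (not_le.2 (this.trans_lt (by linarith)))

end Group

end Step2

namespace Step2

section Slices

variable {m h : ℕ} [NeZero m] {B : Fin h → Matrix (Fin m) (Fin m) ℝ}

/-- The pairing `Σ_{j ≥ 2} g_j u_j` of an intrinsic gradient with a horizontal vector. -/
def hdot (g u : Fin m → ℝ) : ℝ := ∑ j ∈ Finset.univ.erase (0 : Fin m), g j * u j

lemma hdot_add (g u w : Fin m → ℝ) : hdot g (u + w) = hdot g u + hdot g w := by
  simp [hdot, mul_add, Finset.sum_add_distrib]

lemma hdot_smul (g : Fin m → ℝ) (c : ℝ) (u : Fin m → ℝ) : hdot g (c • u) = c * hdot g u := by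
  simp only [hdot, Finset.mul_sum, Pi.smul_apply, smul_eq_mul]
  exact Finset.sum_congr rfl fun j _ => by ring

lemma abs_hdot_sub_le {g g' : Fin m → ℝ} {η : ℝ} (hg : ∀ j, j ≠ 0 → |g j - g' j| ≤ η)
    (hη : 0 ≤ η) (u : Fin m → ℝ) : |hdot g u - hdot g' u| ≤ η * l1 u := by
  rw [hdot, hdot, ← Finset.sum_sub_distrib, l1, Finset.mul_sum]
  refine (Finset.abs_sum_le_sum_abs _ _).trans ?_
  refine (Finset.sum_le_sum fun j hj => ?_).trans
    (Finset.sum_le_sum_of_subset_of_nonneg (Finset.erase_subset _ _)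
      fun j _ _ => mul_nonneg hη (abs_nonneg _))
  rw [← sub_mul, abs_mul]
  exact mul_le_mul_of_nonneg_right (hg j (Finset.ne_of_mem_erase hj)) (abs_nonneg _)

lemma abs_hdot_le (g u : Fin m → ℝ) : |hdot g u| ≤ l1 g * l1 u := by
  have := abs_hdot_sub_le (g := g) (g' := 0) (η := l1 g)
    (fun j _ => by
      simpa [l1] using Finset.single_le_sum (f := fun j => |g j|) (fun _ _ => abs_nonneg _)
        (Finset.mem_univ j)) (l1_nonneg g) u
  simpa [hdot] using this

variable {U : Set (G m h)} {φ : G m h → ℝ} {a₀ : G m h}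

/-- Intrinsic differentiability as an eventual bound for the topology of `W`. -/
lemma IDAt.eventually (hskew : ∀ i, (B i).transpose = -B i) {a : G m h} {g : Fin m → ℝ}
    (hID : IDAt B U φ a g) (hU : U ∈ 𝓝[Wset m h] a) {ε : ℝ} (hε : 0 < ε) :
    ∀ᶠ b in 𝓝[Wset m h] a,
      |φ b - φ a - hdot g (b.1 - a.1)| ≤ ε * hnorm (shiftQ B φ a b) := by
  obtain ⟨r, hr, H⟩ := hID ε hε
  have hlt : ∀ᶠ b in 𝓝[Wset m h] a, gdist B a b < r := by
    refine nhdsWithin_le_nhds ((continuous_gdist a).continuousAt.eventually_lt_const ?_)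
    rwa [gdist_self hskew]
  filter_upwards [hU, hlt] with b hbU hb
  rcases (hnorm_nonneg (gmul B (ginv a) b)).eq_or_lt with h0 | h0
  · rw [eq_of_gdist_eq_zero hskew h0.symm]
    simpa [hdot] using mul_nonneg hε.le (hnorm_nonneg _)
  · exact H b hbU h0 hb

lemma tendsto_slicePoint {X : Type*} {l : Filter X} {p : X → G m h} {u : X → Fin m → ℝ}
    {t s : X → ℝ} {p₀ : G m h} {u₀ : Fin m → ℝ} {t₀ s₀ : ℝ} (hp : Tendsto p l (𝓝[Wset m h] p₀))
    (hu : Tendsto u l (𝓝[{u | u 0 = 0}] u₀)) (ht : Tendsto t l (𝓝 t₀))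
    (hs : Tendsto s l (𝓝 s₀)) :
    Tendsto (fun z => slicePoint B (p z) (u z) (t z) (s z)) l
      (𝓝[Wset m h] (slicePoint B p₀ u₀ t₀ s₀)) := by
  rw [tendsto_nhdsWithin_iff] at hp hu ⊢
  constructor
  · have hc : Continuous fun z : G m h × (Fin m → ℝ) × ℝ × ℝ =>
        slicePoint B z.1 z.2.1 z.2.2.1 z.2.2.2 := by fun_prop
    exact (hc.tendsto (p₀, u₀, t₀, s₀)).comp
      (hp.1.prodMk_nhds (hu.1.prodMk_nhds (ht.prodMk_nhds hs)))
  · filter_upwards [hp.2, hu.2] with z hpz huz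
    exact slicePoint_mem hpz huz _ _

lemma hasDerivAt_slice (hskew : ∀ i, (B i).transpose = -B i) {g : Fin m → ℝ} {p : G m h}
    {u : Fin m → ℝ} (hp : p ∈ Wset m h) (hu : u 0 = 0) {t s : ℝ}
    (hID : IDAt B U φ (slicePoint B p u t s) g) (hU : U ∈ 𝓝[Wset m h] (slicePoint B p u t s))
    (c : ℝ) :
    HasDerivAt (fun r => φ (slicePoint B p u r
      (s + φ (slicePoint B p u t s) * (r - t) + c * (r - t) ^ 2))) (hdot g u) t := by
  set k := φ (slicePoint B p u t s) with hk
  have htend : Tendsto (fun r => slicePoint B p u r (s + k * (r - t) + c * (r - t) ^ 2)) (𝓝 t)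
      (𝓝[Wset m h] (slicePoint B p u t s)) := by
    refine tendsto_slicePoint (tendsto_nhdsWithin_iff.2 ⟨tendsto_const_nhds, by simp [hp]⟩)
      (tendsto_nhdsWithin_iff.2 ⟨tendsto_const_nhds, by simp [hu]⟩) tendsto_id ?_
    have : Continuous fun r => s + k * (r - t) + c * (r - t) ^ 2 := by fun_prop
    simpa using this.tendsto t
  rw [hasDerivAt_iff_isLittleO, Asymptotics.isLittleO_iff]
  intro ε hε
  set C := l1 u + ∑ i, √|c * bil B (Pi.single 0 1) u i| with hC
  have hC0 : 0 ≤ C := add_nonneg (l1_nonneg u) (Finset.sum_nonneg fun _ _ => Real.sqrt_nonneg _)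
  have hε' : 0 < ε / (C + 1) := by positivity
  filter_upwards [htend.eventually (hID.eventually hskew hU hε')] with r hr
  rw [shiftQ_slicePoint hskew, ← hk,
    show s + k * (r - t) + c * (r - t) ^ 2 - s - k * (r - t) = c * (r - t) ^ 2 by ring,
    hnorm_smul_sq_smul, ← hC] at hr
  have h1 : (slicePoint B p u r (s + k * (r - t) + c * (r - t) ^ 2)).1
      - (slicePoint B p u t s).1 = (r - t) • u := by
    simp only [slicePoint]; module
  rw [h1, hdot_smul] at hr
  simp only [sub_self, mul_zero, add_zero, ne_eq, OfNat.ofNat_ne_zero, not_false_eq_true,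
    zero_pow, smul_eq_mul, Real.norm_eq_abs, ← hk]
  refine hr.trans ?_
  rw [div_mul_eq_mul_div, div_le_iff₀ (by positivity)]
  nlinarith [mul_nonneg hε.le (abs_nonneg (r - t))]

lemma eventually_slicePoint_mem {V : Set (G m h)} (hV : V ∈ 𝓝[Wset m h] a₀) (R : ℝ) :
    ∀ᶠ z in 𝓝[Wset m h] a₀ ×ˢ 𝓝[{u : Fin m → ℝ | u 0 = 0}] 0,
      ∀ t s, |t| ≤ R → |s| ≤ R → slicePoint B z.1 z.2 t s ∈ V := by
  obtain ⟨O, hO, ha, hOV⟩ := mem_nhdsWithin.1 hV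
  have hK : IsCompact (Set.Icc (-R) R ×ˢ Set.Icc (-R) R) := isCompact_Icc.prod isCompact_Icc
  have hc : Continuous fun y : (G m h × (Fin m → ℝ)) × ℝ × ℝ =>
      slicePoint B y.1.1 y.1.2 y.2.1 y.2.2 := by fun_prop
  have key := hK.eventually_forall_of_forall_eventually (x₀ := (a₀, (0 : Fin m → ℝ)))
    (P := fun z y => slicePoint B z.1 z.2 y.1 y.2 ∈ O)
    (fun y _ => hc.continuousAt.preimage_mem_nhds
      (hO.mem_nhds (by simpa only [slicePoint_zero_right] using ha)))
  rw [← nhdsWithin_prod_eq]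
  filter_upwards [nhdsWithin_le_nhds key, self_mem_nhdsWithin] with z hz hzW t s ht hs
  exact hOV ⟨hz (t, s) ⟨abs_le.1 ht, abs_le.1 hs⟩, slicePoint_mem hzW.1 hzW.2 t s⟩

/-- The standing assumptions on `φ` : it is continuous and intrinsically differentiable on the open
set `U`, with continuous intrinsic gradient. -/
structure IsIntrinsicC1 (B : Fin h → Matrix (Fin m) (Fin m) ℝ) (U : Set (G m h))
    (φ : G m h → ℝ) (grad : G m h → Fin m → ℝ) : Prop where
  skew : ∀ i, (B i).transpose = -B i
  mem_nhds : ∀ a ∈ U, U ∈ 𝓝[Wset m h] a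
  cont : ∀ a ∈ U, ContinuousWithinAt φ (Wset m h) a
  idAt : ∀ a ∈ U, IDAt B U φ a (grad a)
  cont_grad : ∀ a ∈ U, ∀ j, j ≠ 0 → ContinuousWithinAt (fun b => grad b j) (Wset m h) a

variable {grad : G m h → Fin m → ℝ}

/-- Near `a₀`, all slices of `φ` solve a planar balance law on a large square, with data controlled
by the values of `φ` and of its gradient at `a₀`. -/
lemma IsIntrinsicC1.eventually_isPlanarSolution (H : IsIntrinsicC1 B U φ grad) (ha₀ : a₀ ∈ U)
    {η : ℝ} (hη : 0 < η) (R : ℝ) :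
    ∀ᶠ z in 𝓝[Wset m h] a₀ ×ˢ 𝓝[{u : Fin m → ℝ | u 0 = 0}] 0, l1 z.2 ≤ 1 ∧
      (∀ t s, |t| ≤ R → |s| ≤ R → |φ (slicePoint B z.1 z.2 t s)| ≤ |φ a₀| + 1) ∧
      (z.2 ≠ 0 → IsPlanarSolution (fun t s => φ (slicePoint B z.1 z.2 t s)) R
        (hdot (grad a₀) z.2 - η * l1 z.2) (hdot (grad a₀) z.2 + η * l1 z.2)) := by
  have hV : ∀ᶠ b in 𝓝[Wset m h] a₀, b ∈ U ∧ |φ b| ≤ |φ a₀| + 1 ∧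
      ∀ j, j ≠ 0 → |grad b j - grad a₀ j| ≤ η / 2 := by
    refine Filter.Eventually.and (H.mem_nhds a₀ ha₀) (Filter.Eventually.and ?_ ?_)
    · exact ((H.cont a₀ ha₀).abs.eventually_lt_const (lt_add_one |φ a₀|)).mono fun _ hb => hb.le
    · refine Filter.eventually_all.2 fun j => ?_
      by_cases hj : j = 0
      · exact Eventually.of_forall fun b hb => absurd hj hb
      · have hc : Tendsto (fun b => |grad b j - grad a₀ j|) (𝓝[Wset m h] a₀) (𝓝 0) := by
          simpa using ((H.cont_grad a₀ ha₀ j hj).tendsto.sub_const (grad a₀ j)).abs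
        exact (hc.eventually_lt_const (half_pos hη)).mono fun b hb _ => hb.le
  have hl1 : ∀ᶠ z in 𝓝[Wset m h] a₀ ×ˢ 𝓝[{u : Fin m → ℝ | u 0 = 0}] 0, l1 z.2 ≤ 1 := by
    have h1 : ∀ᶠ u in 𝓝[{u : Fin m → ℝ | u 0 = 0}] 0, l1 u < 1 :=
      nhdsWithin_le_nhds (continuous_l1.continuousAt.eventually_lt_const (by simp [l1]))
    exact (h1.prod_inr _).mono fun _ hz => hz.le
  have hW : ∀ᶠ z in 𝓝[Wset m h] a₀ ×ˢ 𝓝[{u : Fin m → ℝ | u 0 = 0}] 0,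
      z.1 ∈ Wset m h ∧ z.2 0 = 0 :=
    (eventually_mem_nhdsWithin.prod_inl _).and (eventually_mem_nhdsWithin.prod_inr _)
  filter_upwards [hl1, hW, eventually_slicePoint_mem hV R] with z hz1 hzW hz
  refine ⟨hz1, fun t s ht hs => (hz t s ht hs).2.1, fun hz0 t s ht hs => ?_⟩
  obtain ⟨hU, -, hg⟩ := hz t s ht hs
  have hpos := mul_pos hη (l1_pos hz0)
  have hdist := abs_le.1 (abs_hdot_sub_le hg (by positivity) z.2)
  refine ⟨?_, hdot (grad (slicePoint B z.1 z.2 t s)) z.2, by linarith [hdist.1],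
    by linarith [hdist.2], hasDerivAt_slice H.skew hzW.1 hzW.2 (H.idAt _ hU) (H.mem_nhds _ hU)⟩
  exact (H.cont _ hU).tendsto.comp (tendsto_slicePoint
    (tendsto_nhdsWithin_iff.2 ⟨tendsto_const_nhds, by simp [hzW.1]⟩)
    (tendsto_nhdsWithin_iff.2 ⟨tendsto_const_nhds, by simp [hzW.2]⟩)
    (continuous_fst.tendsto (t, s)) (continuous_snd.tendsto (t, s)))

/-- Vertical little Hölder estimate along the direction `⟨B e₁, u⟩`, uniformly in `u`. -/
lemma IsIntrinsicC1.eventually_vertical (H : IsIntrinsicC1 B U φ grad) (ha₀ : a₀ ∈ U)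
    {ε R : ℝ} (hε : 0 < ε) (hR : 0 < R) :
    ∀ᶠ z in 𝓝[Wset m h] a₀ ×ˢ 𝓝[{u : Fin m → ℝ | u 0 = 0}] 0, ∀ s, |s| ≤ R * l1 z.2 →
      |φ (z.1 + (0, s • bil B (Pi.single 0 1) z.2)) - φ z.1| ≤ ε * l1 z.2 := by
  set T := 2 * R / ε with hT
  set η := ε / (2 * T) with hη
  have hT0 : 0 < T := by positivity
  have hη0 : 0 < η := by positivity
  have h1 : η * T ^ 2 = R := by rw [hη, hT]; field_simp
  have h2 : 2 * η * T = ε := by rw [hη]; field_simp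
  set K := |φ a₀| + 1 + l1 (grad a₀) + η with hK
  have hK1 : 1 ≤ K := by linarith [abs_nonneg (φ a₀), l1_nonneg (grad a₀)]
  filter_upwards [H.eventually_isPlanarSolution ha₀ hη0 (R + K * T + K * T ^ 2)]
    with z ⟨hz1, hzφ, hz⟩ s hs
  have hl := l1_nonneg z.2
  by_cases hz0 : z.2 = 0
  · simp only [hz0, map_zero, smul_zero]
    rw [← Prod.zero_eq_mk, add_zero, sub_self, abs_zero]
    exact mul_nonneg hε.le (l1_nonneg _)
  have hdot_le := abs_le.1 (abs_hdot_le (grad a₀) z.2)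
  have hgl : l1 (grad a₀) * l1 z.2 ≤ l1 (grad a₀) := mul_le_of_le_one_right (l1_nonneg _) hz1
  have hηl : η * l1 z.2 ≤ η := mul_le_of_le_one_right hη0.le hz1
  have hηl0 : 0 ≤ η * l1 z.2 := by positivity
  have hsR : |s| ≤ R := hs.trans (mul_le_of_le_one_right hR.le hz1)
  have hTK : T ≤ K * T := le_mul_of_one_le_left hT0.le hK1
  have hKT : 0 ≤ K * T ^ 2 := by positivity
  have habs := abs_nonneg (φ a₀)
  have := (hz hz0).abs_sub_le (s := -s) (K := K) (c := η * l1 z.2) hT0.le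
    (mul_pos hη0 (l1_pos hz0)) (by ring)
    (by rw [abs_neg, mul_right_comm, h1]; exact hs)
    (abs_le.2 ⟨by linarith [hdot_le.1], by linarith [hdot_le.2]⟩)
    (abs_le.2 ⟨by linarith [hdot_le.1], by linarith [hdot_le.2]⟩)
    (fun s' hs' => (hzφ 0 s' (by rw [abs_zero]; positivity) hs').trans
      (by linarith [l1_nonneg (grad a₀)]))
    (by linarith) (by rw [abs_neg]; linarith)
  simp only [slicePoint_zero_left, neg_neg, neg_zero, zero_smul] at this
  rw [← Prod.zero_eq_mk, add_zero] at this
  refine this.trans (le_of_eq ?_)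
  rw [← h2]
  ring

lemma IsIntrinsicC1.tendsto_move (H : IsIntrinsicC1 B U φ grad) (ha₀ : a₀ ∈ U) {X : Type*}
    {l : Filter X} {p : X → G m h} {u : X → Fin m → ℝ} (hp : Tendsto p l (𝓝[Wset m h] a₀))
    (hu : Tendsto u l (𝓝[{u | u 0 = 0}] 0)) :
    Tendsto (fun z => slicePoint B (p z) (u z) 1 (φ (p z))) l (𝓝[Wset m h] a₀) := by
  have := tendsto_slicePoint (B := B) hp hu (tendsto_const_nhds (x := (1 : ℝ)))
    ((H.cont a₀ ha₀).tendsto.comp hp)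
  rwa [slicePoint_zero_right] at this

/-- First order expansion of `φ` along the straight horizontal displacement `u`. -/
lemma IsIntrinsicC1.eventually_horizontal (H : IsIntrinsicC1 B U φ grad) (ha₀ : a₀ ∈ U)
    {ε : ℝ} (hε : 0 < ε) :
    ∀ᶠ z in 𝓝[Wset m h] a₀ ×ˢ 𝓝[{u : Fin m → ℝ | u 0 = 0}] 0,
      |φ (slicePoint B z.1 z.2 1 (φ z.1)) - φ z.1 - hdot (grad a₀) z.2| ≤ ε * l1 z.2 := by
  set η := ε / 3 with hη
  have hη0 : 0 < η := by positivity
  set K := |φ a₀| + 1 + l1 (grad a₀) + η with hK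
  have hg0 := l1_nonneg (grad a₀)
  have habs := abs_nonneg (φ a₀)
  have htend : Tendsto (fun z : G m h × (Fin m → ℝ) => (slicePoint B z.1 z.2 1 (φ z.1), z.2))
      (𝓝[Wset m h] a₀ ×ˢ 𝓝[{u : Fin m → ℝ | u 0 = 0}] 0)
      (𝓝[Wset m h] a₀ ×ˢ 𝓝[{u : Fin m → ℝ | u 0 = 0}] 0) :=
    (H.tendsto_move ha₀ tendsto_fst tendsto_snd).prodMk tendsto_snd
  filter_upwards [H.eventually_isPlanarSolution ha₀ hη0 (0 + K * 1 + K * 1 ^ 2),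
    htend.eventually (H.eventually_vertical ha₀ hη0
      (show 0 < l1 (grad a₀) + 2 * η by positivity))] with z ⟨hz1, hzφ, hz⟩ hzv
  have hl := l1_nonneg z.2
  by_cases hz0 : z.2 = 0
  · simpa [hz0, slicePoint_zero_right, hdot] using mul_nonneg hε.le (l1_nonneg _)
  have hdot_le := abs_le.1 (abs_hdot_le (grad a₀) z.2)
  have hgl : l1 (grad a₀) * l1 z.2 ≤ l1 (grad a₀) := mul_le_of_le_one_right (l1_nonneg _) hz1
  have hηl : η * l1 z.2 ≤ η := mul_le_of_le_one_right hη0.le hz1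
  have hηl0 : 0 < η * l1 z.2 := mul_pos hη0 (l1_pos hz0)
  have hφz := hzφ 0 0 (by rw [abs_zero]; positivity) (by rw [abs_zero]; positivity)
  have h00 : slicePoint B z.1 z.2 0 0 = z.1 := by simp [slicePoint]
  rw [h00] at hφz
  have hφz' := abs_le.1 hφz
  have h1R : (1 : ℝ) ≤ 0 + K * 1 + K * 1 ^ 2 := by linarith
  have hup := (hz hz0).lt_of_parabola (s := 0) (v := φ z.1 + η * l1 z.2) zero_le_one h1R
    (fun t ht => abs_parabola_le abs_zero.le
      (abs_le.2 ⟨by linarith [hφz'.1], by linarith [hφz'.2]⟩)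
      (abs_le.2 ⟨by linarith [hdot_le.1], by linarith [hdot_le.2]⟩) ht)
    (by rw [h00]; linarith)
  have hlo := (hz hz0).gt_of_parabola (s := 0) (v := φ z.1 - η * l1 z.2) zero_le_one h1R
    (fun t ht => abs_parabola_le abs_zero.le
      (abs_le.2 ⟨by linarith [hφz'.1], by linarith [hφz'.2]⟩)
      (abs_le.2 ⟨by linarith [hdot_le.1], by linarith [hdot_le.2]⟩) ht)
    (by rw [h00]; linarith)
  have hshift : ∀ s, slicePoint B z.1 z.2 1 s = slicePoint B z.1 z.2 1 (φ z.1)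
      + (0, (φ z.1 - s) • bil B (Pi.single 0 1) z.2) := by
    intro s
    simp only [slicePoint]
    refine Prod.ext (by simp) ?_
    simp only [Prod.snd_add]
    module
  rw [hshift] at hup hlo
  have hv1 := abs_le.1 (hzv (φ z.1 - (0 + (φ z.1 + η * l1 z.2) * 1
    + (hdot (grad a₀) z.2 + η * l1 z.2) / 2 * 1 ^ 2))
    (abs_le.2 ⟨by linarith [hdot_le.1], by linarith [hdot_le.2]⟩))
  have hv2 := abs_le.1 (hzv (φ z.1 - (0 + (φ z.1 - η * l1 z.2) * 1
    + (hdot (grad a₀) z.2 - η * l1 z.2) / 2 * 1 ^ 2))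
    (abs_le.2 ⟨by linarith [hdot_le.1], by linarith [hdot_le.2]⟩))
  have hε3 : ε * l1 z.2 = 3 * (η * l1 z.2) := by rw [hη]; ring
  rw [abs_le]
  constructor <;> linarith [hv1.1, hv1.2, hv2.1, hv2.2]

end Slices

end Step2

namespace Step2

lemma add_vertical_add {m h : ℕ} (p : G m h) (v w : Fin h → ℝ) :
    p + (0, v) + (0, w) = p + (0, v + w) :=
  Prod.ext (by simp) (by simp [add_assoc])

section Vertical

variable {m h : ℕ} [NeZero m] {B : Fin h → Matrix (Fin m) (Fin m) ℝ}
  {U : Set (G m h)} {φ : G m h → ℝ} {a₀ : G m h} {grad : G m h → Fin m → ℝ}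

lemma tendsto_add_vertical {X : Type*} {l : Filter X} {p : X → G m h} {z : X → Fin h → ℝ}
    (hp : Tendsto p l (𝓝[Wset m h] a₀)) (hz : Tendsto z l (𝓝 0)) :
    Tendsto (fun x => p x + (0, z x)) l (𝓝[Wset m h] a₀) := by
  rw [tendsto_nhdsWithin_iff] at hp ⊢
  constructor
  · have := hp.1.add ((tendsto_const_nhds (x := (0 : Fin m → ℝ))).prodMk_nhds hz)
    rwa [← Prod.zero_eq_mk, add_zero] at this
  · filter_upwards [hp.2] with x hx
    simpa [Wset] using hx

/-- `φ` is little `1/2`-Hölder at `a₀` in the vertical direction `v`, on the side of `v`. -/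
def IsLittleHolderDir (φ : G m h → ℝ) (a₀ : G m h) (v : Fin h → ℝ) : Prop :=
  ∀ ε > 0, ∀ᶠ q in 𝓝[Wset m h] a₀ ×ˢ 𝓝 (0 : ℝ),
    |φ (q.1 + (0, q.2 ^ 2 • v)) - φ q.1| ≤ ε * |q.2|

lemma tendsto_add_sq_smul (v : Fin h → ℝ) :
    Tendsto (fun q : G m h × ℝ => q.1 + (0, q.2 ^ 2 • v)) (𝓝[Wset m h] a₀ ×ˢ 𝓝 (0 : ℝ))
      (𝓝[Wset m h] a₀) := by
  refine tendsto_add_vertical tendsto_fst ?_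
  have : Continuous fun t : ℝ => t ^ 2 • v := by fun_prop
  simpa [Function.comp_def] using (this.tendsto 0).comp tendsto_snd

lemma IsLittleHolderDir.zero : IsLittleHolderDir φ a₀ 0 := by
  intro ε hε
  refine Eventually.of_forall fun q => ?_
  rw [smul_zero, ← Prod.zero_eq_mk, add_zero, sub_self, abs_zero]
  positivity

lemma IsLittleHolderDir.add {v w : Fin h → ℝ} (hv : IsLittleHolderDir φ a₀ v)
    (hw : IsLittleHolderDir φ a₀ w) : IsLittleHolderDir φ a₀ (v + w) := by
  intro ε hε
  filter_upwards [hv (ε / 2) (by positivity),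
    ((tendsto_add_sq_smul v).prodMk tendsto_snd).eventually (hw (ε / 2) (by positivity))]
    with q h1 h2
  have : q.1 + (0, q.2 ^ 2 • (v + w)) = q.1 + (0, q.2 ^ 2 • v) + (0, q.2 ^ 2 • w) := by
    rw [add_vertical_add, smul_add]
  rw [this]
  refine (abs_sub_le _ (φ (q.1 + (0, q.2 ^ 2 • v))) _).trans ?_
  linarith

lemma IsLittleHolderDir.neg {v : Fin h → ℝ} (hv : IsLittleHolderDir φ a₀ v) :
    IsLittleHolderDir φ a₀ (-v) := by
  intro ε hε
  filter_upwards [((tendsto_add_sq_smul (-v)).prodMk tendsto_snd).eventually (hv ε hε)] with q hq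
  rw [add_vertical_add, smul_neg, neg_add_cancel, ← Prod.zero_eq_mk, add_zero] at hq
  rwa [abs_sub_comm, smul_neg]

lemma IsLittleHolderDir.sq_smul {v : Fin h → ℝ} (hv : IsLittleHolderDir φ a₀ v) (c : ℝ) :
    IsLittleHolderDir φ a₀ (c ^ 2 • v) := by
  intro ε hε
  have ht : Tendsto (fun q : G m h × ℝ => (q.1, c * q.2)) (𝓝[Wset m h] a₀ ×ˢ 𝓝 (0 : ℝ))
      (𝓝[Wset m h] a₀ ×ˢ 𝓝 (0 : ℝ)) := by
    refine tendsto_fst.prodMk ?_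
    simpa using (tendsto_snd (f := 𝓝[Wset m h] a₀) (g := 𝓝 (0 : ℝ))).const_mul c
  filter_upwards [ht.eventually (hv (ε / (|c| + 1)) (by positivity))] with q hq
  rw [smul_smul, mul_comm, ← mul_pow]
  refine hq.trans ?_
  rw [abs_mul, div_mul_eq_mul_div, div_le_iff₀ (by positivity)]
  nlinarith [mul_nonneg hε.le (abs_nonneg q.2)]

lemma IsLittleHolderDir.smul {v : Fin h → ℝ} (hv : IsLittleHolderDir φ a₀ v) (c : ℝ) :
    IsLittleHolderDir φ a₀ (c • v) := by
  rcases le_total 0 c with hc | hc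
  · simpa only [Real.sq_sqrt hc] using hv.sq_smul √c
  · have := hv.neg.sq_smul √(-c)
    rwa [Real.sq_sqrt (neg_nonneg.2 hc), smul_neg, neg_smul, neg_neg] at this

lemma tendsto_smul_direction {u : Fin m → ℝ} (hu : u 0 = 0) :
    Tendsto (fun q : G m h × ℝ => q.2 • u) (𝓝[Wset m h] a₀ ×ˢ 𝓝 (0 : ℝ))
      (𝓝[{u : Fin m → ℝ | u 0 = 0}] 0) := by
  refine tendsto_nhdsWithin_iff.2 ⟨?_, Eventually.of_forall fun q => by simp [hu]⟩
  simpa using (tendsto_snd (f := 𝓝[Wset m h] a₀) (g := 𝓝 (0 : ℝ))).smul_const u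

lemma IsIntrinsicC1.isLittleHolderDir_bil_single_zero (H : IsIntrinsicC1 B U φ grad)
    (ha₀ : a₀ ∈ U) {j : Fin m} (hj : j ≠ 0) :
    IsLittleHolderDir φ a₀ (bil B (Pi.single 0 1) (Pi.single j 1)) := by
  intro ε hε
  have hu : (Pi.single j 1 : Fin m → ℝ) 0 = 0 := by simp [hj.symm]
  filter_upwards [(tendsto_fst.prodMk (tendsto_smul_direction hu)).eventually
    (H.eventually_vertical ha₀ hε one_pos)] with q hq
  simp only [l1_smul, l1_single, one_mul, mul_one] at hq
  have := hq q.2 le_rfl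
  rwa [map_smul, smul_smul, ← sq] at this

/-- Three horizontal displacements closing up a triangle produce a vertical displacement. -/
lemma slicePoint_triangle (hskew : ∀ i, (B i).transpose = -B i) (q : G m h) (u w : Fin m → ℝ)
    (a b c : ℝ) :
    slicePoint B (slicePoint B (slicePoint B q (-(u + w)) 1 a) u 1 b) w 1 c
        + (0, (-(a - c)) • bil B (Pi.single 0 1) w) + (0, (-(a - b)) • bil B (Pi.single 0 1) u)
      = q + (0, (1 / 2 : ℝ) • bil B w u) := by
  refine Prod.ext ?_ ?_
  · simp only [slicePoint, Prod.fst_add]; module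
  · simp only [slicePoint, Prod.snd_add, map_add, map_neg, map_smul, LinearMap.add_apply,
      LinearMap.neg_apply, LinearMap.smul_apply, bil_self hskew]
    rw [bil_swap hskew u w]
    module

lemma IsIntrinsicC1.isLittleHolderDir_bil_single (H : IsIntrinsicC1 B U φ grad)
    (ha₀ : a₀ ∈ U) {j k : Fin m} (hj : j ≠ 0) (hk : k ≠ 0) :
    IsLittleHolderDir φ a₀ ((1 / 2 : ℝ) • bil B (Pi.single k 1) (Pi.single j 1)) := by
  intro ε hε
  set u : Fin m → ℝ := Pi.single j 1 with hu_def
  set w : Fin m → ℝ := Pi.single k 1 with hw_def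
  have hu : u 0 = 0 := by simp [hu_def, hj.symm]
  have hw : w 0 = 0 := by simp [hw_def, hk.symm]
  have hlu : ∀ t : ℝ, l1 (t • u) = |t| := fun t => by rw [l1_smul, l1_single, mul_one]
  have hlw : ∀ t : ℝ, l1 (t • w) = |t| := fun t => by rw [l1_smul, l1_single, mul_one]
  have htu := tendsto_smul_direction (a₀ := a₀) hu
  have htw := tendsto_smul_direction (a₀ := a₀) hw
  have htv : Tendsto (fun q : G m h × ℝ => -(q.2 • u + q.2 • w)) (𝓝[Wset m h] a₀ ×ˢ 𝓝 (0 : ℝ))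
      (𝓝[{u : Fin m → ℝ | u 0 = 0}] 0) := by
    have := tendsto_smul_direction (a₀ := a₀) (u := -(u + w)) (by simp [hu, hw])
    simpa only [smul_neg, smul_add] using this
  set p₁ : G m h × ℝ → G m h := fun q => slicePoint B q.1 (-(q.2 • u + q.2 • w)) 1 (φ q.1)
    with hp₁
  set p₂ : G m h × ℝ → G m h := fun q => slicePoint B (p₁ q) (q.2 • u) 1 (φ (p₁ q)) with hp₂
  set p₃ : G m h × ℝ → G m h := fun q => slicePoint B (p₂ q) (q.2 • w) 1 (φ (p₂ q)) with hp₃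
  set p₄ : G m h × ℝ → G m h := fun q =>
    p₃ q + (0, (-(φ q.1 - φ (p₂ q))) • bil B (Pi.single 0 1) (q.2 • w)) with hp₄
  have ht₁ : Tendsto p₁ _ _ := H.tendsto_move ha₀ tendsto_fst htv
  have ht₂ : Tendsto p₂ _ _ := H.tendsto_move ha₀ ht₁ htu
  have ht₃ : Tendsto p₃ _ _ := H.tendsto_move ha₀ ht₂ htw
  have hφa := (H.cont a₀ ha₀).tendsto
  have ht₄ : Tendsto p₄ (𝓝[Wset m h] a₀ ×ˢ 𝓝 (0 : ℝ)) (𝓝[Wset m h] a₀) := by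
    refine tendsto_add_vertical ht₃ ?_
    have h1 : Tendsto (fun q : G m h × ℝ => bil B (Pi.single 0 1) (q.2 • w))
        (𝓝[Wset m h] a₀ ×ˢ 𝓝 (0 : ℝ)) (𝓝 0) := by
      have hc : Continuous fun u : Fin m → ℝ => bil B (Pi.single 0 1) u := by fun_prop
      simpa [Function.comp_def] using (hc.tendsto 0).comp (htw.mono_right nhdsWithin_le_nhds)
    simpa using ((hφa.comp tendsto_fst).sub (hφa.comp ht₂)).neg.smul h1
  set δ := min (ε / 8) 1 with hδ
  have hδ0 : 0 < δ := lt_min (by positivity) one_pos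
  have hδ1 : δ ≤ 1 := min_le_right _ _
  have hδε : δ ≤ ε / 8 := min_le_left _ _
  set N := l1 (grad a₀) with hN
  have hN0 : 0 ≤ N := l1_nonneg _
  have hhor : ∀ᶠ z in 𝓝[Wset m h] a₀ ×ˢ 𝓝[{u : Fin m → ℝ | u 0 = 0}] 0,
      |φ (slicePoint B z.1 z.2 1 (φ z.1)) - φ z.1 - hdot (grad a₀) z.2| ≤ δ * l1 z.2 ∧
      |φ (slicePoint B z.1 z.2 1 (φ z.1)) - φ z.1| ≤ (N + 1) * l1 z.2 := by
    filter_upwards [H.eventually_horizontal ha₀ hδ0] with z hz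
    refine ⟨hz, ?_⟩
    have h1 := abs_hdot_le (grad a₀) z.2
    have h2 : δ * l1 z.2 ≤ l1 z.2 := mul_le_of_le_one_left (l1_nonneg _) hδ1
    have h3 := abs_add_le (φ (slicePoint B z.1 z.2 1 (φ z.1)) - φ z.1 - hdot (grad a₀) z.2)
      (hdot (grad a₀) z.2)
    rw [sub_add_cancel] at h3
    linarith
  have hver := H.eventually_vertical ha₀ hδ0 (show 0 < 3 * (N + 1) by positivity)
  filter_upwards [(tendsto_fst.prodMk htv).eventually hhor, (ht₁.prodMk htu).eventually hhor,
    (ht₂.prodMk htw).eventually hhor, (ht₃.prodMk htw).eventually hver,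
    (ht₄.prodMk htu).eventually hver] with q h1 h2 h3 h4 h5
  simp only [hlu, hlw] at h2 h3 h4 h5
  have hlv : l1 (-(q.2 • u + q.2 • w)) ≤ 2 * |q.2| := by
    have : -(q.2 • u + q.2 • w) = (-q.2) • u + (-q.2) • w := by module
    rw [this]
    refine (l1_add_le _ _).trans ?_
    rw [hlu, hlw, abs_neg]
    linarith
  have hq0 := abs_nonneg q.2
  have h1a : |φ (p₁ q) - φ q.1 - hdot (grad a₀) (-(q.2 • u + q.2 • w))| ≤ δ * (2 * |q.2|) :=
    h1.1.trans (by gcongr)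
  have h1b : |φ (p₁ q) - φ q.1| ≤ (N + 1) * (2 * |q.2|) := h1.2.trans (by gcongr)
  have h2a : |φ (p₂ q) - φ (p₁ q) - hdot (grad a₀) (q.2 • u)| ≤ δ * |q.2| := h2.1
  have h2b : |φ (p₂ q) - φ (p₁ q)| ≤ (N + 1) * |q.2| := h2.2
  have h3a : |φ (p₃ q) - φ (p₂ q) - hdot (grad a₀) (q.2 • w)| ≤ δ * |q.2| := h3.1
  have hNq : 0 ≤ (N + 1) * |q.2| := by positivity
  rw [abs_le] at h1a h1b h2a h2b h3a
  have h4a : |φ (p₄ q) - φ (p₃ q)| ≤ δ * |q.2| :=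
    h4 _ (abs_le.2 ⟨by linarith, by linarith⟩)
  have h5a := h5 (-(φ q.1 - φ (p₁ q))) (abs_le.2 ⟨by linarith, by linarith⟩)
  have hfin : p₄ q + (0, (-(φ q.1 - φ (p₁ q))) • bil B (Pi.single 0 1) (q.2 • u))
      = q.1 + (0, q.2 ^ 2 • (1 / 2 : ℝ) • bil B w u) := by
    simp only [hp₄, hp₃, hp₂]
    rw [slicePoint_triangle H.skew]
    simp only [map_smul, LinearMap.smul_apply]
    refine congrArg (fun z => q.1 + ((0 : Fin m → ℝ), z)) ?_
    module
  rw [hfin] at h5a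
  have hdot0 : hdot (grad a₀) (-(q.2 • u + q.2 • w))
      = -(hdot (grad a₀) (q.2 • u) + hdot (grad a₀) (q.2 • w)) := by
    rw [← neg_one_smul ℝ, hdot_smul, hdot_add]
    ring
  rw [hdot0] at h1a
  rw [abs_le] at h4a h5a
  have hδq : 8 * (δ * |q.2|) ≤ ε * |q.2| := by nlinarith
  have hδq0 : 0 ≤ δ * |q.2| := by positivity
  rw [abs_le]
  constructor <;> linarith

/-- `φ` is little Hölder in every vertical direction. -/
lemma IsIntrinsicC1.isLittleHolderDir (H : IsIntrinsicC1 B U φ grad) (ha₀ : a₀ ∈ U)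
    (hBli : LinearIndependent ℝ B) (v : Fin h → ℝ) : IsLittleHolderDir φ a₀ v := by
  let S : Submodule ℝ (Fin h → ℝ) :=
    { carrier := {v | IsLittleHolderDir φ a₀ v}
      add_mem' := fun hv hw => hv.add hw
      zero_mem' := IsLittleHolderDir.zero
      smul_mem' := fun c _ hv => hv.smul c }
  have hentry : ∀ j k, (fun i => B i j k) ∈ S := by
    intro j k
    have hjk : (fun i => B i j k) = bil B (Pi.single k 1) (Pi.single j 1) :=
      funext fun i => (bil_single_single j k i).symm
    rw [hjk]
    by_cases hj : j = 0
    · by_cases hk : k = 0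
      · rw [hj, hk, bil_self H.skew]
        exact S.zero_mem
      · rw [bil_swap H.skew, hj]
        exact S.neg_mem (H.isLittleHolderDir_bil_single_zero ha₀ hk)
    · by_cases hk : k = 0
      · rw [hk]
        exact H.isLittleHolderDir_bil_single_zero ha₀ hj
      · have := S.smul_mem (2 : ℝ) (show _ ∈ S from H.isLittleHolderDir_bil_single ha₀ hj hk)
        rwa [smul_smul, show (2 : ℝ) * (1 / 2) = 1 by norm_num, one_smul] at this
  have htop : S = ⊤ := by
    by_contra hS
    obtain ⟨f, hf0, hfS⟩ := Submodule.exists_le_ker_of_lt_top S (lt_top_iff_ne_top.2 hS)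
    have hfapp : ∀ v, f v = ∑ i, f (Pi.single i 1) * v i := by
      intro v
      rw [LinearMap.pi_apply_eq_sum_univ f v]
      refine Finset.sum_congr rfl fun i _ => ?_
      rw [smul_eq_mul, mul_comm]
      congr 2
      ext i'
      simp [Pi.single_apply, eq_comm]
    have hsum : ∑ i, f (Pi.single i 1) • B i = 0 := by
      ext j k
      have := hfS (hentry j k)
      rw [LinearMap.mem_ker, hfapp] at this
      simpa [Matrix.sum_apply] using this
    have hzero := Fintype.linearIndependent_iff.1 hBli _ hsum
    exact hf0 (LinearMap.ext fun v => by simp [hfapp v, hzero])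
  have : v ∈ S := htop ▸ Submodule.mem_top
  exact this

lemma IsIntrinsicC1.eventually_add_vertical (H : IsIntrinsicC1 B U φ grad) (ha₀ : a₀ ∈ U)
    (hBli : LinearIndependent ℝ B) {ε : ℝ} (hε : 0 < ε) :
    ∀ᶠ q in 𝓝[Wset m h] a₀ ×ˢ 𝓝 (0 : Fin h → ℝ),
      |φ (q.1 + (0, q.2)) - φ q.1| ≤ ε * ∑ i, √|q.2 i| := by
  have hcoord : ∀ i, ∀ᶠ q in 𝓝[Wset m h] a₀ ×ˢ 𝓝 (0 : ℝ),
      |φ (q.1 + (0, q.2 • Pi.single i 1)) - φ q.1| ≤ ε * √|q.2| := by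
    intro i
    have ht : Tendsto (fun q : G m h × ℝ => (q.1, √|q.2|)) (𝓝[Wset m h] a₀ ×ˢ 𝓝 (0 : ℝ))
        (𝓝[Wset m h] a₀ ×ˢ 𝓝 (0 : ℝ)) := by
      refine tendsto_fst.prodMk ?_
      have hc : Continuous fun s : ℝ => √|s| := by fun_prop
      simpa [Function.comp_def] using (hc.tendsto 0).comp
        (tendsto_snd (f := 𝓝[Wset m h] a₀) (g := 𝓝 (0 : ℝ)))
    filter_upwards [ht.eventually (H.isLittleHolderDir ha₀ hBli (Pi.single i 1) ε hε),
      ht.eventually (H.isLittleHolderDir ha₀ hBli (-Pi.single i 1) ε hε)] with q h1 h2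
    simp only [Real.sq_sqrt (abs_nonneg _), abs_of_nonneg (Real.sqrt_nonneg _)] at h1 h2
    rcases abs_choice q.2 with hq | hq
    · rwa [hq] at h1 ⊢
    · rw [hq, neg_smul_neg] at h2
      rwa [hq]
  have hsum : ∀ S : Finset (Fin h), ∀ᶠ q in 𝓝[Wset m h] a₀ ×ˢ 𝓝 (0 : Fin h → ℝ),
      |φ (q.1 + (0, ∑ i ∈ S, q.2 i • Pi.single i 1)) - φ q.1| ≤ ε * ∑ i ∈ S, √|q.2 i| := by
    intro S
    induction S using Finset.induction_on with
    | empty =>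
      refine Eventually.of_forall fun q => ?_
      simp only [Finset.sum_empty]
      rw [← Prod.zero_eq_mk, add_zero, sub_self, abs_zero, mul_zero]
    | insert i S hi ih =>
      have hz : Tendsto (fun q : G m h × (Fin h → ℝ) => ∑ i ∈ S, q.2 i • Pi.single i (1 : ℝ))
          (𝓝[Wset m h] a₀ ×ˢ 𝓝 (0 : Fin h → ℝ)) (𝓝 (0 : Fin h → ℝ)) := by
        have hc : Continuous fun z : Fin h → ℝ =>
            ∑ i ∈ S, z i • (Pi.single i (1 : ℝ) : Fin h → ℝ) := by fun_prop
        simpa [Function.comp_def] using (hc.tendsto 0).comp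
          (tendsto_snd (f := 𝓝[Wset m h] a₀) (g := 𝓝 (0 : Fin h → ℝ)))
      have hi0 : Tendsto (fun q : G m h × (Fin h → ℝ) => q.2 i)
          (𝓝[Wset m h] a₀ ×ˢ 𝓝 (0 : Fin h → ℝ)) (𝓝 0) :=
        ((continuous_apply i).tendsto (0 : Fin h → ℝ)).comp tendsto_snd
      filter_upwards [ih, ((tendsto_add_vertical tendsto_fst hz).prodMk hi0).eventually
        (hcoord i)] with q h1 h2
      rw [Finset.sum_insert hi, Finset.sum_insert hi, mul_add]
      rw [add_vertical_add, add_comm (∑ i ∈ S, _)] at h2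
      exact (abs_sub_le _ _ _).trans (add_le_add h2 h1)
  filter_upwards [hsum Finset.univ] with q hq
  have hq2 : ∑ i, q.2 i • Pi.single i (1 : ℝ) = q.2 := by
    ext i'
    simp [Finset.sum_apply, Pi.single_apply]
  rwa [hq2] at hq

lemma IsIntrinsicC1.uidAt (H : IsIntrinsicC1 B U φ grad) (hUW : U ⊆ Wset m h) (ha₀ : a₀ ∈ U)
    (hBli : LinearIndependent ℝ B) : UIDAt B U φ a₀ (grad a₀) := by
  intro ε hε
  have hu : Tendsto (fun q : G m h × G m h => q.2.1 - q.1.1)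
      (𝓝[Wset m h] a₀ ×ˢ 𝓝[Wset m h] a₀) (𝓝[{u : Fin m → ℝ | u 0 = 0}] 0) := by
    have h1 : Tendsto (fun q : G m h => q.1) (𝓝[Wset m h] a₀) (𝓝[{u | u 0 = 0}] a₀.1) :=
      tendsto_nhdsWithin_iff.2 ⟨continuous_fst.continuousWithinAt.tendsto, self_mem_nhdsWithin⟩
    have h2 := tendsto_nhdsWithin_iff.1 (h1.comp (tendsto_snd (f := 𝓝[Wset m h] a₀)))
    have h3 := tendsto_nhdsWithin_iff.1 (h1.comp (tendsto_fst (g := 𝓝[Wset m h] a₀)))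
    refine tendsto_nhdsWithin_iff.2 ⟨by simpa using h2.1.sub h3.1, ?_⟩
    filter_upwards [h2.2, h3.2] with q hq2 hq3
    have h4 : q.2.1 0 = 0 := hq2
    have h5 : q.1.1 0 = 0 := hq3
    simp [h4, h5]
  have hT : Tendsto (fun q : G m h × G m h => (shiftQ B φ q.1 q.2).2)
      (𝓝[Wset m h] a₀ ×ˢ 𝓝[Wset m h] a₀) (𝓝 0) := by
    simp only [shiftQ_eq H.skew]
    have hc : Continuous fun z : (G m h × G m h) × ℝ => z.1.2.2 - z.1.1.2
        + (1 / 2 : ℝ) • bil B z.1.1.1 (z.1.2.1 - z.1.1.1)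
        + z.2 • bil B (Pi.single 0 1) (z.1.2.1 - z.1.1.1) := by fun_prop
    have hid : Tendsto (fun q : G m h × G m h => q) (𝓝[Wset m h] a₀ ×ˢ 𝓝[Wset m h] a₀)
        (𝓝 (a₀, a₀)) := by
      rw [nhds_prod_eq]
      exact Filter.prod_mono nhdsWithin_le_nhds nhdsWithin_le_nhds
    have := (hc.tendsto ((a₀, a₀), φ a₀)).comp
      (hid.prodMk_nhds ((H.cont a₀ ha₀).tendsto.comp tendsto_fst))
    simpa [Function.comp_def] using this
  have key : ∀ᶠ q in 𝓝[Wset m h] a₀ ×ˢ 𝓝[Wset m h] a₀,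
      |φ q.2 - φ q.1 - hdot (grad a₀) (q.2.1 - q.1.1)| ≤ ε * hnorm (shiftQ B φ q.1 q.2) := by
    filter_upwards [(tendsto_fst.prodMk hu).eventually (H.eventually_horizontal ha₀ hε),
      ((H.tendsto_move ha₀ tendsto_fst hu).prodMk hT).eventually
        (H.eventually_add_vertical ha₀ hBli hε)] with q h1 h2
    have hq : slicePoint B q.1 (q.2.1 - q.1.1) 1 (φ q.1) + (0, (shiftQ B φ q.1 q.2).2) = q.2 := by
      rw [shiftQ_eq H.skew]
      refine Prod.ext (by simp [slicePoint]) ?_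
      simp only [slicePoint, Prod.snd_add]
      module
    rw [hq] at h2
    have hn : hnorm (shiftQ B φ q.1 q.2)
        = l1 (q.2.1 - q.1.1) + ∑ i, √|(shiftQ B φ q.1 q.2).2 i| := by
      have : (shiftQ B φ q.1 q.2).1 = q.2.1 - q.1.1 := by rw [shiftQ_eq H.skew]
      rw [hnorm, l1, this]
    rw [hn, mul_add]
    rw [abs_le] at h1 h2 ⊢
    constructor <;> linarith
  obtain ⟨V, hV, hVV⟩ := Filter.mem_prod_same_iff.1 key
  obtain ⟨r, hr, hrV⟩ := exists_gdist_lt_imp_mem H.skew hV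
  exact ⟨r, hr, fun a ha b hb har hbr _ => hVV (Set.mk_mem_prod (hrV a (hUW ha) har)
    (hrV b (hUW hb) hbr))⟩

end Vertical

end Step2

namespace Step2

/-- If `φ` is intrinsically differentiable at every point of `U` and the
intrinsic gradient map is continuous on `U`, then `φ ∈ UID(U)`. -/
theorem statement10 (m h : ℕ) [NeZero m] (hm : 2 ≤ m) (hh : 1 ≤ h)
    (B : Fin h → Matrix (Fin m) (Fin m) ℝ)
    (hskew : ∀ i, (B i).transpose = - B i) (hBli : LinearIndependent ℝ B)
    (U : Set (G m h)) (hUW : U ⊆ Wset m h) (hUopen : RelOpen m h U)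
    (φ : G m h → ℝ) (hφ : ContinuousOn φ U)
    (grad : G m h → Fin m → ℝ)
    (hID : ∀ a ∈ U, IDAt B U φ a (grad a))
    (hcont : ∀ j : Fin m, j ≠ 0 → ContinuousOn (fun a => grad a j) U) :
    ∀ a₀ ∈ U, ∃ g : Fin m → ℝ, UIDAt B U φ a₀ g := by
  intro a₀ ha₀
  obtain ⟨O, hO, rfl⟩ := hUopen
  have hmem : ∀ a ∈ O ∩ Wset m h, O ∩ Wset m h ∈ 𝓝[Wset m h] a := fun a ha =>
    Filter.inter_mem (mem_nhdsWithin_of_mem_nhds (hO.mem_nhds ha.1)) self_mem_nhdsWithin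
  have H : IsIntrinsicC1 B (O ∩ Wset m h) φ grad :=
    { skew := hskew
      mem_nhds := hmem
      cont := fun a ha => (hφ a ha).mono_of_mem_nhdsWithin (hmem a ha)
      idAt := hID
      cont_grad := fun a ha j hj => (hcont j hj a ha).mono_of_mem_nhdsWithin (hmem a ha) }
  exact ⟨grad a₀, H.uidAt hUW ha₀ hBli⟩

end Step2
end

section
/- Assume D^φφ = ω in the broad* sense on U for some continuous ω : U → ℝ^{k×(2n−k)}. Then φ satisfies the following vertical (1/2)-little Hölder property: for every a_0 ∈ U there exists an open neighborhood U_{a_0} of a_0 with compact closure contained in U such that lim_{ρ→0} sup{ |φ(ξ,z_1) − φ(ξ,z_2)| / |z_1 − z_2|^{1/2} : (ξ,z_1),(ξ,z_2) ∈ U_{a_0}, 0 < |z_1 − z_2| < ρ } = 0, where a point of W is written (ξ,z) with ξ = (x_{k+1},…,x_{2n}) ∈ ℝ^{2n−k} and z = x_{2n+1} ∈ ℝ, and |·| on the left-hand side is the Euclidean norm of ℝ^k. -/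
open MeasureTheory Filter Topology

namespace Heis

/-- The underlying space of the Heisenberg group `H^n = ℝ^(2n) × ℝ`. -/
abbrev H (n : ℕ) := (Fin (2 * n) → ℝ) × ℝ

/-- The index `i` among the first `n` horizontal coordinates. -/
def loIdx {n : ℕ} (i : Fin n) : Fin (2 * n) := ⟨(i : ℕ), by have := i.isLt; omega⟩

/-- The index `n + i` among the last `n` horizontal coordinates. -/
def hiIdx {n : ℕ} (i : Fin n) : Fin (2 * n) := ⟨n + (i : ℕ), by have := i.isLt; omega⟩

/-- The Heisenberg group product. -/
noncomputable def hmul {n : ℕ} (p q : H n) : H n :=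
  (p.1 + q.1, p.2 + q.2 + (1 / 2) * ∑ i : Fin n,
    (p.1 (loIdx i) * q.1 (hiIdx i) - p.1 (hiIdx i) * q.1 (loIdx i)))

/-- Group inverse `a⁻¹ = -a`. -/
def hinv {n : ℕ} (p : H n) : H n := (-p.1, -p.2)

/-- Homogeneous norm `‖a‖ = Σ_{j≤2n} |a_j| + |a_{2n+1}|^(1/2)`. -/
noncomputable def hnormH {n : ℕ} (p : H n) : ℝ :=
  (∑ j, |p.1 j|) + Real.sqrt |p.2|

/-- Homogeneous (quasi-)distance `d(p,q) = ‖p⁻¹·q‖`. -/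
noncomputable def hdist {n : ℕ} (p q : H n) : ℝ := hnormH (hmul (hinv p) q)

/-- Euclidean distance on `H^n`. -/
noncomputable def eDistH {n : ℕ} (p q : H n) : ℝ :=
  Real.sqrt ((∑ j, (p.1 j - q.1 j) ^ 2) + (p.2 - q.2) ^ 2)

/-- The subgroup `W = {x_1 = … = x_k = 0}`. -/
def WsetH (n k : ℕ) : Set (H n) := {p | ∀ j : Fin (2 * n), (j : ℕ) < k → p.1 j = 0}

/-- `U` is (relatively) open in `W`. -/
def RelOpenH (n k : ℕ) (U : Set (H n)) : Prop :=
  ∃ O : Set (H n), IsOpen O ∧ U = O ∩ WsetH n k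

/-- The graphing map `Φ(w) = (φ^(1)(w),…,φ^(k)(w),0,…,0) ∈ L`. -/
noncomputable def PhiH {n : ℕ} (k : ℕ) (φ : H n → Fin k → ℝ) (w : H n) : H n :=
  ((fun j => if hj : (j : ℕ) < k then φ w ⟨(j : ℕ), hj⟩ else 0), 0)

/-- The projected vector fields `D^φ_j` on `W` (0-based index `j`, used for `k ≤ j < 2n`):
`∂_{x_j} - (1/2)x_{n+j}∂_z` for `k ≤ j < n`; `∂_{x_{n+i}} + φ^(i)∂_z` for `j = n+i`, `i < k`;
`∂_{x_{n+j'}} + (1/2)x_{j'}∂_z` for `j = n+j'`, `k ≤ j' < n`. -/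
noncomputable def DvecH {n : ℕ} (k : ℕ) (φ : H n → Fin k → ℝ) (j : Fin (2 * n))
    (w : H n) : H n :=
  ((fun j' => if j' = j then 1 else 0),
   if hj : (j : ℕ) < n then -(1 / 2) * w.1 ⟨n + (j : ℕ), by omega⟩
   else if h2 : (j : ℕ) - n < k then φ w ⟨(j : ℕ) - n, h2⟩
   else (1 / 2) * w.1 ⟨(j : ℕ) - n, by have := j.isLt; omega⟩)

/-- `D^φφ = ω` in the broad* sense on `U ⊆ W ⊆ H^n`. -/
def IsBroadStarH (n k : ℕ) (U : Set (H n)) (φ : H n → Fin k → ℝ)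
    (ω : H n → Fin k → Fin (2 * n) → ℝ) : Prop :=
  ∀ a₀ ∈ U, ∃ δ₁ δ₂ : ℝ, 0 < δ₂ ∧ δ₂ < δ₁ ∧
    ∀ j : Fin (2 * n), k ≤ (j : ℕ) → ∃ E : H n → ℝ → H n,
      ∀ a, a ∈ U → eDistH a a₀ ≤ δ₂ →
        (∀ t ∈ Set.Icc (-δ₂) δ₂, E a t ∈ U ∧ eDistH (E a t) a₀ ≤ δ₁) ∧
        E a 0 = a ∧
        (∀ t ∈ Set.Icc (-δ₂) δ₂,
          HasDerivWithinAt (E a) (DvecH k φ j (E a t)) (Set.Icc (-δ₂) δ₂) t) ∧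
        (∀ t ∈ Set.Icc (-δ₂) δ₂, ∀ l : Fin k,
          φ (E a t) l - φ a l = ∫ s in (0:ℝ)..t, ω (E a s) l j)

/-- `φ` is uniformly intrinsically differentiable at `a₀` with intrinsic gradient
(the matrix) `grad`. -/
def UIDAtH (n k : ℕ) (U : Set (H n)) (φ : H n → Fin k → ℝ) (a₀ : H n)
    (grad : Fin k → Fin (2 * n) → ℝ) : Prop :=
  ∀ ε > (0:ℝ), ∃ r > (0:ℝ), ∀ a ∈ U, ∀ b ∈ U,
    hdist a₀ a < r → hdist a₀ b < r → a ≠ b →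
    Real.sqrt (∑ l : Fin k, (φ b l - φ a l -
        ∑ j ∈ Finset.univ.filter (fun j : Fin (2 * n) => k ≤ (j : ℕ)),
          grad l j * (b.1 j - a.1 j)) ^ 2)
      ≤ ε * hnormH (hmul (hmul (hmul (hinv (PhiH k φ a)) (hinv a)) b) (PhiH k φ a))

end Heis

namespace Heis

/-- A curve whose speed is less than `C` as long as it stays within distance `r` of its starting
point moves by at most `C * t` up to time `t`, provided `C * t ≤ r`. -/
lemma norm_sub_le_of_speed_lt_of_nonneg {V : Type*} [NormedAddCommGroup V] [NormedSpace ℝ V]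
    {f f' : ℝ → V} {δ C r : ℝ}
    (hf : ∀ t ∈ Set.Icc (-δ) δ, HasDerivWithinAt f (f' t) (Set.Icc (-δ) δ) t)
    (hb : ∀ t ∈ Set.Icc (-δ) δ, ‖f t - f 0‖ ≤ r → ‖f' t‖ < C) (hC : 0 ≤ C)
    {t : ℝ} (ht0 : 0 ≤ t) (htδ : t ≤ δ) (htr : C * t ≤ r) :
    ‖f t - f 0‖ ≤ C * t := by
  have hsub : Set.Icc 0 t ⊆ Set.Icc (-δ) δ := Set.Icc_subset_Icc (by linarith) htδ
  refine image_norm_le_of_norm_deriv_right_lt_deriv_boundary' (f := fun x => f x - f 0)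
    (f' := f') (a := 0) (b := t) (B := fun x => C * x) (B' := fun _ => C)
    ?_ ?_ (by simp) (by fun_prop) ?_ ?_ ⟨ht0, le_rfl⟩
  · exact fun x hx => (((hf x (hsub hx)).continuousWithinAt).mono hsub).sub
      continuousWithinAt_const
  · intro x hx
    have hx' := hsub (Set.Ico_subset_Icc_self hx)
    refine ((hf x hx').sub_const (f 0)).mono_of_mem_nhdsWithin ?_
    refine Filter.mem_of_superset (Icc_mem_nhdsGE (lt_of_lt_of_le hx.2 htδ)) ?_
    exact Set.Icc_subset_Icc_left hx'.1
  · intro x _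
    simpa using ((hasDerivAt_id x).const_mul C).hasDerivWithinAt (s := Set.Ici x)
  · intro x hx hxeq
    refine hb x (hsub (Set.Ico_subset_Icc_self hx)) ?_
    rw [hxeq]
    exact (mul_le_mul_of_nonneg_left hx.2.le hC).trans htr

/-- Two-sided version of `norm_sub_le_of_speed_lt_of_nonneg`. -/
lemma norm_sub_le_of_speed_lt {V : Type*} [NormedAddCommGroup V] [NormedSpace ℝ V]
    {f f' : ℝ → V} {δ C r : ℝ}
    (hf : ∀ t ∈ Set.Icc (-δ) δ, HasDerivWithinAt f (f' t) (Set.Icc (-δ) δ) t)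
    (hb : ∀ t ∈ Set.Icc (-δ) δ, ‖f t - f 0‖ ≤ r → ‖f' t‖ < C) (hC : 0 ≤ C)
    {t : ℝ} (htδ : |t| ≤ δ) (htr : C * |t| ≤ r) :
    ‖f t - f 0‖ ≤ C * |t| := by
  rcases le_total 0 t with h | h
  · rw [abs_of_nonneg h] at *
    exact norm_sub_le_of_speed_lt_of_nonneg hf hb hC h htδ htr
  · rw [abs_of_nonpos h] at *
    have hneg : ∀ x ∈ Set.Icc (-δ) δ, -x ∈ Set.Icc (-δ) δ := fun x hx =>
      ⟨by linarith [hx.2], by linarith [hx.1]⟩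
    have := norm_sub_le_of_speed_lt_of_nonneg (f := fun x => f (-x)) (f' := fun x => -f' (-x))
      (δ := δ) (C := C) (r := r) ?_ ?_ hC (t := -t) (by linarith) htδ htr
    · simpa using this
    · intro x hx
      have h1 := (hf (-x) (hneg x hx)).scomp x
        ((hasDerivAt_neg x).hasDerivWithinAt (s := Set.Icc (-δ) δ)) hneg
      simpa [Function.comp_def] using h1
    · intro x hx hxr
      rw [norm_neg]
      exact hb (-x) (hneg x hx) (by simpa using hxr)

/-- If a function starts at height `h`, its derivative `v` varies slowly, and `v` vanishes at
every zero of the function, then the initial slope is at least `-ε * √h`. -/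
lemma neg_mul_sqrt_le_of_slope_eq_zero {g v : ℝ → ℝ} {h ε T : ℝ} (hh : 0 < h) (hε : 0 < ε)
    (hT : T = 2 * √h / ε) (hg0 : g 0 = h)
    (hg : ∀ t ∈ Set.Icc 0 T, HasDerivWithinAt g (v t) (Set.Icc 0 T) t)
    (hv : ∀ t ∈ Set.Icc 0 T, |v t - v 0| ≤ ε ^ 2 / 4 * t)
    (hz : ∀ t ∈ Set.Icc 0 T, g t = 0 → v t = 0) : -(ε * √h) ≤ v 0 := by
  by_contra! hlt
  have hs : 0 < √h := Real.sqrt_pos.2 hh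
  have hT0 : 0 < T := by rw [hT]; positivity
  have hvt : ∀ t ∈ Set.Icc 0 T, v t ≤ -(ε * √h / 2) := by
    intro t ht
    have h1 := (abs_le.1 (hv t ht)).2
    have h2 : ε ^ 2 / 4 * t ≤ ε ^ 2 / 4 * T := mul_le_mul_of_nonneg_left ht.2 (by positivity)
    have h3 : ε ^ 2 / 4 * T = ε * √h / 2 := by rw [hT]; field_simp; norm_num
    linarith
  have hcont : ContinuousOn g (Set.Icc 0 T) := fun t ht => (hg t ht).continuousWithinAt
  have hgT : g T ≤ 0 := by
    have h1 := image_le_of_deriv_right_le_deriv_boundary (f := g) (f' := v) (a := 0) (b := T)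
      (B := fun t => h - ε * √h / 2 * t) (B' := fun _ => -(ε * √h / 2)) hcont
      (fun x hx => (hg x (Set.Ico_subset_Icc_self hx)).mono_of_mem_nhdsWithin
        (Filter.mem_of_superset (Icc_mem_nhdsGE hx.2) (Set.Icc_subset_Icc_left hx.1)))
      (by simp [hg0]) (by fun_prop)
      (fun x _ => by
        simpa using (((hasDerivAt_id x).const_mul (ε * √h / 2)).const_sub h).hasDerivWithinAt
          (s := Set.Ici x))
      (fun x hx => hvt x (Set.Ico_subset_Icc_self hx)) (Set.right_mem_Icc.2 hT0.le)
    have h2 : h - ε * √h / 2 * T = 0 := by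
      rw [hT]
      field_simp
      rw [Real.sq_sqrt hh.le]
      ring
    exact h1.trans h2.le
  obtain ⟨t, ht, hgt⟩ := intermediate_value_Icc' hT0.le hcont ⟨hgT, by rw [hg0]; exact hh.le⟩
  have h1 := hvt t ht
  rw [hz t ht hgt] at h1
  have : 0 < ε * √h := mul_pos hε hs
  linarith

/-- The `z`-component of the field `D^φ_{n+l}`, `l < k`, is `φ^(l)`. -/
lemma DvecH_hiIdx_snd {n k : ℕ} (hkn : k < n) (φ : H n → Fin k → ℝ) (l : Fin k) (w : H n) :
    (DvecH k φ (hiIdx ⟨l, l.isLt.trans hkn⟩) w).2 = φ w l := by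
  simp [DvecH, hiIdx]

lemma norm_DvecH_hiIdx_le {n k : ℕ} (hkn : k < n) (φ : H n → Fin k → ℝ) (l : Fin k) (w : H n) :
    ‖DvecH k φ (hiIdx ⟨l, l.isLt.trans hkn⟩) w‖ ≤ max 1 |φ w l| := by
  refine max_le_max ?_ ?_
  · refine (pi_norm_le_iff_of_nonneg zero_le_one).2 fun i => ?_
    simp only [DvecH]
    split_ifs <;> simp
  · rw [DvecH_hiIdx_snd hkn, Real.norm_eq_abs]

/-- `γ` is a `C^1` integral curve in `U` of `D^φ_j`, on the time interval `[-δ, δ]`, along which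
the `l`-th component of `φ` has derivative `η`. -/
structure IsBroadCurve {n k : ℕ} (U : Set (H n)) (φ : H n → Fin k → ℝ) (j : Fin (2 * n))
    (l : Fin k) (η : H n → ℝ) (δ : ℝ) (γ : ℝ → H n) : Prop where
  mem : ∀ t ∈ Set.Icc (-δ) δ, γ t ∈ U
  deriv : ∀ t ∈ Set.Icc (-δ) δ,
    HasDerivWithinAt γ (DvecH k φ j (γ t)) (Set.Icc (-δ) δ) t
  integral : ∀ t ∈ Set.Icc (-δ) δ, φ (γ t) l - φ (γ 0) l = ∫ s in (0:ℝ)..t, η (γ s)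

namespace IsBroadCurve

variable {n k : ℕ} {U : Set (H n)} {φ : H n → Fin k → ℝ} {j : Fin (2 * n)} {l : Fin k}
  {η : H n → ℝ} {δ : ℝ} {γ γ₁ γ₂ : ℝ → H n}

lemma continuousOn (h : IsBroadCurve U φ j l η δ γ) : ContinuousOn γ (Set.Icc (-δ) δ) :=
  fun t ht => (h.deriv t ht).continuousWithinAt

lemma fst_eq (h₁ : IsBroadCurve U φ j l η δ γ₁) (h₂ : IsBroadCurve U φ j l η δ γ₂)
    (h0 : (γ₁ 0).1 = (γ₂ 0).1) {t : ℝ} (ht : t ∈ Set.Icc (-δ) δ) : (γ₁ t).1 = (γ₂ t).1 := by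
  have hz : (0:ℝ) ∈ Set.Icc (-δ) δ := ⟨by linarith [ht.1, ht.2], by linarith [ht.1, ht.2]⟩
  have hd : ∀ s ∈ Set.Icc (-δ) δ,
      HasDerivWithinAt (fun s => (γ₁ s).1 - (γ₂ s).1) 0 (Set.Icc (-δ) δ) s := by
    intro s hs
    have d₁ := (ContinuousLinearMap.fst ℝ (Fin (2 * n) → ℝ) ℝ).hasFDerivAt.comp_hasDerivWithinAt
      s (h₁.deriv s hs)
    have d₂ := (ContinuousLinearMap.fst ℝ (Fin (2 * n) → ℝ) ℝ).hasFDerivAt.comp_hasDerivWithinAt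
      s (h₂.deriv s hs)
    exact (d₁.sub d₂).congr_deriv (sub_self _)
  have := (convex_Icc (-δ) δ).norm_image_sub_le_of_norm_hasDerivWithin_le (C := 0) hd
    (fun _ _ => by simp) hz ht
  simp only [zero_mul, norm_le_zero_iff, h0, sub_self, sub_zero] at this
  exact sub_eq_zero.1 this

lemma snd_deriv (hkn : k < n)
    (h : IsBroadCurve U φ (hiIdx ⟨l, l.isLt.trans hkn⟩) l η δ γ) {t : ℝ}
    (ht : t ∈ Set.Icc (-δ) δ) :
    HasDerivWithinAt (fun s => (γ s).2) (φ (γ t) l) (Set.Icc (-δ) δ) t := by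
  have := (ContinuousLinearMap.snd ℝ (Fin (2 * n) → ℝ) ℝ).hasFDerivAt.comp_hasDerivWithinAt
    t (h.deriv t ht)
  rw [← DvecH_hiIdx_snd hkn φ l]
  exact this

lemma abs_sub_sub_le (h₁ : IsBroadCurve U φ j l η δ γ₁) (h₂ : IsBroadCurve U φ j l η δ γ₂)
    (hη : ContinuousOn η U) {β t : ℝ} (ht : |t| ≤ δ)
    (hβ : ∀ s, |s| ≤ |t| → |η (γ₁ s) - η (γ₂ s)| ≤ β) :
    |(φ (γ₁ t) l - φ (γ₂ t) l) - (φ (γ₁ 0) l - φ (γ₂ 0) l)| ≤ β * |t| := by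
  have ht' : t ∈ Set.Icc (-δ) δ := abs_le.1 ht
  have h0 : (0:ℝ) ∈ Set.Icc (-δ) δ := abs_le.1 (by simpa using (abs_nonneg t).trans ht)
  have hsub : Set.uIcc 0 t ⊆ Set.Icc (-δ) δ := Set.uIcc_subset_Icc h0 ht'
  have hi : ∀ {γ : ℝ → H n}, IsBroadCurve U φ j l η δ γ →
      IntervalIntegrable (fun s => η (γ s)) volume 0 t := fun h =>
    ((hη.comp h.continuousOn h.mem).mono hsub).intervalIntegrable
  have heq : (φ (γ₁ t) l - φ (γ₂ t) l) - (φ (γ₁ 0) l - φ (γ₂ 0) l)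
      = ∫ s in (0:ℝ)..t, (η (γ₁ s) - η (γ₂ s)) := by
    rw [intervalIntegral.integral_sub (hi h₁) (hi h₂), ← h₁.integral t ht', ← h₂.integral t ht']
    ring
  rw [heq, ← Real.norm_eq_abs]
  refine (intervalIntegral.norm_integral_le_of_norm_le_const fun s hs => ?_).trans
    (by rw [sub_zero])
  refine hβ s ?_
  rcases Set.mem_uIoc.1 hs with h | h
  · rw [abs_of_pos h.1]
    exact h.2.trans (le_abs_self t)
  · rw [abs_of_nonpos h.2]
    exact (neg_le_neg h.1.le).trans (neg_le_abs t)

end IsBroadCurve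

/-- Vertical little Hölder estimate for a single component of `φ`. -/
lemma eventually_abs_sub_le_mul_sqrt {n k : ℕ} (hkn : k < n) {U N K : Set (H n)}
    {φ : H n → Fin k → ℝ} {l : Fin k} {η : H n → ℝ} {δ r M : ℝ} (hδ : 0 < δ) (hr : 0 < r)
    (hη : ContinuousOn η U) (hK : IsCompact K) (hKU : K ⊆ U)
    (hNK : ∀ a ∈ N, ∀ b ∈ U, ‖b - a‖ ≤ r → b ∈ K) (hM : ∀ b ∈ K, |φ b l| ≤ M)
    {E : H n → ℝ → H n} (hE0 : ∀ a ∈ N, E a 0 = a)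
    (hE : ∀ a ∈ N, IsBroadCurve U φ (hiIdx ⟨l, l.isLt.trans hkn⟩) l η δ (E a))
    {ε : ℝ} (hε : 0 < ε) :
    ∀ᶠ h in 𝓝[>] (0:ℝ), ∀ p ∈ N, ∀ q ∈ N, p.1 = q.1 → p.2 - q.2 = h →
      |φ p l - φ q l| ≤ ε * √h := by
  set C : ℝ := max 1 M + 1 with hC
  have hC0 : 0 < C := by have := le_max_left 1 M; linarith
  obtain ⟨κ, hκ, hκη⟩ := Metric.uniformContinuousOn_iff.1
    (hK.uniformContinuousOn_of_continuous (hη.mono hKU)) (ε ^ 2 / 4) (by positivity)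
  have htend : ∀ c : ℝ, 0 < c → ∀ f : ℝ → ℝ, Continuous f → f 0 = 0 →
      ∀ᶠ h in 𝓝[>] (0:ℝ), f h < c := fun c hc f hf hf0 =>
    nhdsWithin_le_nhds ((hf.tendsto' 0 0 hf0).eventually (gt_mem_nhds hc))
  filter_upwards [self_mem_nhdsWithin,
    htend δ hδ (fun h => 2 * √h / ε) (by fun_prop) (by simp),
    htend r hr (fun h => C * (2 * √h / ε)) (by fun_prop) (by simp),
    htend κ hκ (fun h => h + 2 * (C * (2 * √h / ε))) (by fun_prop) (by simp)]
    with h hh hTδ hTr hTκ p hp q hq hpq hpqh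
  have hh : 0 < h := hh
  set T : ℝ := 2 * √h / ε with hT
  have hmove : ∀ a ∈ N, ∀ s, |s| ≤ T → ‖E a s - a‖ ≤ C * T ∧ E a s ∈ K := by
    intro a ha s hs
    have hsT : C * |s| ≤ C * T := mul_le_mul_of_nonneg_left hs hC0.le
    have h1 := norm_sub_le_of_speed_lt (r := r) (C := C) (hE a ha).deriv (fun t ht htr => by
      rw [hE0 a ha] at htr
      refine (norm_DvecH_hiIdx_le hkn φ l _).trans_lt ?_
      have := max_le_max_left 1 (hM _ (hNK a ha _ ((hE a ha).mem t ht) htr))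
      linarith) hC0.le (hs.trans hTδ.le) (hsT.trans hTr.le)
    rw [hE0 a ha] at h1
    have h2 := h1.trans hsT
    exact ⟨h2, hNK a ha _ ((hE a ha).mem s (abs_le.1 (hs.trans hTδ.le))) (h2.trans hTr.le)⟩
  have hpqn : ‖p - q‖ = h := by
    simp [Prod.norm_def, hpq, hpqh, abs_of_pos hh, hh.le]
  have hβ : ∀ s, |s| ≤ T → |η (E p s) - η (E q s)| ≤ ε ^ 2 / 4 := by
    intro s hs
    obtain ⟨hp1, hp2⟩ := hmove p hp s hs
    obtain ⟨hq1, hq2⟩ := hmove q hq s hs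
    refine (hκη _ hp2 _ hq2 ?_).le
    have : E p s - E q s = (E p s - p) + (p - q) - (E q s - q) := by abel
    rw [dist_eq_norm, this]
    have h3 := norm_sub_le (E p s - p + (p - q)) (E q s - q)
    have h4 := norm_add_le (E p s - p) (p - q)
    linarith
  have hsign : ∀ σ : ℝ, |σ| = 1 → -(ε * √h) ≤ σ * (φ p l - φ q l) := by
    intro σ hσ
    have habs : ∀ t ∈ Set.Icc 0 T, |σ * t| = t := fun t ht => by
      rw [abs_mul, hσ, one_mul, abs_of_nonneg ht.1]
    have hmem : ∀ t ∈ Set.Icc 0 T, σ * t ∈ Set.Icc (-δ) δ := fun t ht =>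
      abs_le.1 ((habs t ht).trans_le (ht.2.trans hTδ.le))
    have := neg_mul_sqrt_le_of_slope_eq_zero (g := fun t => (E p (σ * t)).2 - (E q (σ * t)).2)
      (v := fun t => σ * (φ (E p (σ * t)) l - φ (E q (σ * t)) l)) hh hε hT
      (by simp [hE0 p hp, hE0 q hq, hpqh]) ?_ ?_ ?_
    · simpa [hE0 p hp, hE0 q hq] using this
    · intro t ht
      have hd := ((hE p hp).snd_deriv hkn (hmem t ht)).sub ((hE q hq).snd_deriv hkn (hmem t ht))
      have hm : HasDerivWithinAt (fun t => σ * t) σ (Set.Icc 0 T) t := by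
        simpa using ((hasDerivAt_id t).const_mul σ).hasDerivWithinAt (s := Set.Icc 0 T)
      simpa [Function.comp_def] using hd.scomp t hm hmem
    · intro t ht
      have := (hE p hp).abs_sub_sub_le (hE q hq) hη (β := ε ^ 2 / 4) (t := σ * t)
        ((habs t ht).trans_le (ht.2.trans hTδ.le)) (fun s hs => hβ s
          (hs.trans ((habs t ht).trans_le ht.2)))
      rw [habs t ht] at this
      rw [← mul_sub, abs_mul, hσ, one_mul, mul_zero]
      exact this
    · intro t ht hgt
      have h1 := (hE p hp).fst_eq (hE q hq) (by rw [hE0 p hp, hE0 q hq, hpq]) (hmem t ht)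
      have h2 : E p (σ * t) = E q (σ * t) := Prod.ext h1 (sub_eq_zero.1 hgt)
      simp only [h2, sub_self, mul_zero]
  have h1 := hsign 1 (by simp)
  have h2 := hsign (-1) (by simp)
  exact abs_le.2 ⟨by linarith, by linarith⟩

lemma isClosed_WsetH (n k : ℕ) : IsClosed (WsetH n k) := by
  simp only [WsetH, Set.ofPred_forall]
  exact isClosed_iInter fun j => isClosed_iInter fun _ =>
    isClosed_eq (by fun_prop) continuous_const

/-- In `H^n` (`n ≥ 2`, `1 ≤ k < n`), if `D^φφ = ω` in the broad* sense on
`U` for some continuous `ω`, then `φ` satisfies the vertical `(1/2)`-little Hölder property: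
around every point of `U` there is a relatively open neighborhood with compact closure in `U`
on which `lim_{ρ→0} sup |φ(ξ,z₁)-φ(ξ,z₂)|/|z₁-z₂|^(1/2) = 0`. -/
theorem statement12 (n k : ℕ) (hn : 2 ≤ n) (hk : 1 ≤ k) (hkn : k < n)
    (U : Set (H n)) (hUW : U ⊆ WsetH n k) (hUopen : RelOpenH n k U)
    (φ : H n → Fin k → ℝ) (hφ : ContinuousOn φ U)
    (ω : H n → Fin k → Fin (2 * n) → ℝ)
    (hω : ∀ l : Fin k, ∀ j : Fin (2 * n), k ≤ (j : ℕ) →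
      ContinuousOn (fun w => ω w l j) U)
    (hbroad : IsBroadStarH n k U φ ω) :
    ∀ a₀ ∈ U, ∃ U' : Set (H n), RelOpenH n k U' ∧ a₀ ∈ U' ∧
      IsCompact (closure U') ∧ closure U' ⊆ U ∧
      ∀ ε > (0:ℝ), ∃ ρ > (0:ℝ), ∀ p ∈ U', ∀ q ∈ U',
        p.1 = q.1 → 0 < |p.2 - q.2| → |p.2 - q.2| < ρ →
        Real.sqrt (∑ l : Fin k, (φ p l - φ q l) ^ 2) ≤ ε * Real.sqrt |p.2 - q.2| := by
  intro a₀ ha₀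
  obtain ⟨O, hO, hUO⟩ := hUopen
  obtain ⟨δ₁, δ₂, hδ₂, -, hflow⟩ := hbroad a₀ ha₀
  have ha₀' : a₀ ∈ O ∩ WsetH n k := hUO ▸ ha₀
  obtain ⟨R, hR, hRO⟩ := Metric.nhds_basis_closedBall.mem_iff.1 (hO.mem_nhds ha₀'.1)
  have hdist : ∀ᶠ a in 𝓝 a₀, eDistH a a₀ < δ₂ := by
    have hc : Continuous fun a : H n => eDistH a a₀ := by unfold eDistH; fun_prop
    exact (hc.tendsto' a₀ 0 (by simp [eDistH])).eventually (gt_mem_nhds hδ₂)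
  obtain ⟨r', hr', hr'δ⟩ := Metric.eventually_nhds_iff_ball.1 hdist
  set r : ℝ := min r' (R / 2) with hr
  have hr0 : 0 < r := lt_min hr' (by linarith)
  have hrR : r ≤ R / 2 := min_le_right _ _
  set K : Set (H n) := Metric.closedBall a₀ R ∩ WsetH n k with hKdef
  have hK : IsCompact K := (isCompact_closedBall a₀ R).inter_right (isClosed_WsetH n k)
  have hKU : K ⊆ U := hUO ▸ Set.inter_subset_inter_left _ hRO
  set N : Set (H n) := Metric.ball a₀ r ∩ WsetH n k with hN
  have hNK' : N ⊆ K := Set.inter_subset_inter_left _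
    (Metric.ball_subset_closedBall.trans (Metric.closedBall_subset_closedBall (by linarith)))
  have hclos : closure N ⊆ K := closure_minimal hNK' hK.isClosed
  refine ⟨N, ⟨_, Metric.isOpen_ball, rfl⟩, ⟨Metric.mem_ball_self hr0, ha₀'.2⟩,
    hK.of_isClosed_subset isClosed_closure hclos, hclos.trans hKU, fun ε hε => ?_⟩
  have hNK : ∀ a ∈ N, ∀ b ∈ U, ‖b - a‖ ≤ R / 2 → b ∈ K := by
    intro a ha b hb hba
    refine ⟨?_, hUW hb⟩
    rw [← dist_eq_norm] at hba
    have h1 := dist_triangle b a a₀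
    have h2 : dist a a₀ < r := ha.1
    exact Metric.mem_closedBall.2 (by linarith)
  obtain ⟨M, hM⟩ := (hK.image_of_continuousOn (hφ.mono hKU)).isBounded.exists_norm_le
  have hk0 : (0:ℝ) < k := by exact_mod_cast hk
  have hcomp : ∀ l : Fin k, ∀ᶠ h in 𝓝[>] (0:ℝ), ∀ p ∈ N, ∀ q ∈ N, p.1 = q.1 → p.2 - q.2 = h →
      |φ p l - φ q l| ≤ ε / √k * √h := by
    intro l
    have hj : k ≤ ((hiIdx ⟨l, l.isLt.trans hkn⟩ : Fin (2 * n)) : ℕ) := by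
      simp only [hiIdx]
      omega
    obtain ⟨E, hE⟩ := hflow _ hj
    have hE' : ∀ a ∈ N, _ := fun a ha => hE a (hKU (hNK' ha))
      (hr'δ a (Metric.ball_subset_ball (min_le_left _ _) ha.1)).le
    refine eventually_abs_sub_le_mul_sqrt hkn hδ₂ (half_pos hR) (hω l _ hj) hK hKU hNK (M := M)
      (fun b hb => ?_) (E := E) (fun a ha => (hE' a ha).2.1) (fun a ha => ?_) (by positivity)
    · exact (norm_le_pi_norm (φ b) l).trans (hM _ (Set.mem_image_of_mem φ hb))
    · obtain ⟨h1, h2, h3, h4⟩ := hE' a ha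
      exact ⟨fun t ht => (h1 t ht).1, h3, fun t ht => by rw [h2]; exact h4 t ht l⟩
  obtain ⟨ρ, hρ, hsub⟩ := mem_nhdsGT_iff_exists_Ioo_subset.1 (eventually_all.2 hcomp)
  have main : ∀ p ∈ N, ∀ q ∈ N, p.1 = q.1 → 0 < p.2 - q.2 → p.2 - q.2 < ρ →
      Real.sqrt (∑ l : Fin k, (φ p l - φ q l) ^ 2) ≤ ε * Real.sqrt (p.2 - q.2) := by
    intro p hp q hq hpq h0 h1
    refine Real.sqrt_le_iff.2 ⟨by positivity, ?_⟩
    calc ∑ l : Fin k, (φ p l - φ q l) ^ 2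
        ≤ ∑ _l : Fin k, (ε / √k * √(p.2 - q.2)) ^ 2 := Finset.sum_le_sum fun l _ =>
          sq_le_sq' (abs_le.1 (hsub ⟨h0, h1⟩ l p hp q hq hpq rfl)).1
            (abs_le.1 (hsub ⟨h0, h1⟩ l p hp q hq hpq rfl)).2
      _ = (ε * √(p.2 - q.2)) ^ 2 := by
          simp only [Finset.sum_const, Finset.card_univ, Fintype.card_fin, nsmul_eq_mul,
            mul_pow, div_pow, Real.sq_sqrt hk0.le]
          field_simp
  refine ⟨ρ, hρ, fun p hp q hq hpq h0 h1 => ?_⟩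
  rcases le_total 0 (p.2 - q.2) with h | h
  · rw [abs_of_nonneg h] at *
    exact main p hp q hq hpq h0 h1
  · rw [abs_of_nonpos h, neg_sub] at *
    have := main q hq p hp hpq.symm h0 h1
    simpa only [sub_sq_comm] using this

end Heis
end
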